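/- Let (S_n)_{n∈ℕ} be a sequence of centered random vectors in ℝ^d (E[S_n] = 0) such that: (MC2') the covariances satisfy κ(S_n^{(i)}, S_n^{(j)}) = N_n D_n K_{ij} (1 + O(√(D_n/N_n))), with constant B in the O(·), for a positive-definite symmetric matrix K and D_n/N_n → 0; and (MC3) for any r ≥ 3 and any indices i₁,…,i_r ∈ {1,…,d}, |κ(S_n^{(i₁)},…,S_n^{(i_r)})| ≤ N_n (2D_n)^{r−1} A^r r^{r−2}. Then there exists a constant C = C(d, K, A, B), depending only on d, K, A and B, such that for all n large enough, d_convex(Y_n, N(0,K)) ≤ C √(D_n/N_n), where Y_n = S_n/√(N_n D_n). -/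

import Mathlib

open MeasureTheory Filter
open scoped Topology ENNReal BigOperators

noncomputable section

/-- The quadratic form `x ↦ xᵗ K x` associated to a `d × d` real matrix. -/
def qf {d : ℕ} (K : Matrix (Fin d) (Fin d) ℝ) (x : EuclideanSpace ℝ (Fin d)) : ℝ :=
  ∑ i, ∑ j, x i * K i j * x j

/-- The Gaussian distribution `N(0, K)` on `ℝ^d`. -/
def gaussianMeasure (d : ℕ) (K : Matrix (Fin d) (Fin d) ℝ) :
    Measure (EuclideanSpace ℝ (Fin d)) :=
  volume.withDensity fun x =>
    ENNReal.ofReal (Real.sqrt (((2 * Real.pi) ^ d * K.det)⁻¹) * Real.exp (-(qf K⁻¹ x) / 2))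

/-- The convex distance between two measures on `ℝ^d`. -/
def convexDist {d : ℕ} (μ ν : Measure (EuclideanSpace ℝ (Fin d))) : ℝ :=
  ⨆ C : {C : Set (EuclideanSpace ℝ (Fin d)) // Convex ℝ C ∧ MeasurableSet C},
    |(μ C.1).toReal - (ν C.1).toReal|

/-- The joint cumulant `κ(Y₁,…,Y_r)`, as a sum over set partitions of `{1,…,r}`. -/
def jointCumulant {Ω : Type*} [MeasurableSpace Ω] (ℙ : Measure Ω) {r : ℕ}
    (Y : Fin r → Ω → ℝ) : ℝ :=
  ∑ P ∈ Finset.univ.filter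
      (fun P : Finset (Finset (Fin r)) =>
        (∀ p ∈ P, p.Nonempty) ∧ (∀ p ∈ P, ∀ q ∈ P, p ≠ q → p ∩ q = ∅) ∧
          P.sup id = Finset.univ),
    (-1 : ℝ) ^ (P.card - 1) * (P.card - 1).factorial * ∏ p ∈ P, ∫ ω, ∏ i ∈ p, Y i ω ∂ℙ

section
open Finset

/-- `P` is a set partition of the finite set `s`. -/
def SetPart {α : Type*} [DecidableEq α] (s : Finset α) (P : Finset (Finset α)) : Prop :=
  (∀ p ∈ P, p.Nonempty) ∧ (∀ p ∈ P, ∀ q ∈ P, p ≠ q → p ∩ q = ∅) ∧ P.sup id = s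

/-- Weighted sum over set partitions of `s`. -/
noncomputable def partSum {α : Type*} [DecidableEq α] [Fintype α] (m : ℕ → ℂ) (f : ℕ → ℂ)
    (s : Finset α) : ℂ := by
  classical
  exact ∑ P ∈ Finset.univ.filter (fun P : Finset (Finset α) => SetPart s P),
    f P.card * ∏ p ∈ P, m p.card

lemma SetPart.sub {α : Type*} [DecidableEq α] {s : Finset α} {P : Finset (Finset α)}
    (h : SetPart s P) {p : Finset α} (hp : p ∈ P) : p ⊆ s := by
  rw [← h.2.2]; exact Finset.le_sup (f := id) hp

lemma SetPart.exists_mem {α : Type*} [DecidableEq α] {s : Finset α} {P : Finset (Finset α)}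
    (h : SetPart s P) {a : α} (ha : a ∈ s) : ∃ p ∈ P, a ∈ p := by
  rw [← h.2.2, Finset.mem_sup] at ha; simpa using ha

lemma setPart_empty {α : Type*} [DecidableEq α] (P : Finset (Finset α)) :
    SetPart ∅ P ↔ P = ∅ := by
  constructor
  · intro h
    by_contra hne
    obtain ⟨p, hp⟩ := Finset.nonempty_iff_ne_empty.2 hne
    obtain ⟨x, hx⟩ := h.1 p hp
    exact absurd (h.sub hp hx) (by simp)
  · rintro rfl
    exact ⟨by simp, by simp, by simp⟩

lemma partSum_empty {α : Type*} [DecidableEq α] [Fintype α] (m f : ℕ → ℂ) :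
    partSum m f (∅ : Finset α) = f 0 := by
  classical
  unfold partSum
  have : (Finset.univ.filter (fun P : Finset (Finset α) => SetPart ∅ P)) = {∅} := by
    ext P; simp [setPart_empty]
  rw [this]; simp

lemma setPart_insert {α : Type*} [DecidableEq α] {s T : Finset α} {a : α} (ha : a ∉ s)
    (hT : T ⊆ s) {Q : Finset (Finset α)} (hQ : SetPart (s \ T) Q) :
    SetPart (insert a s) (insert (insert a T) Q) := by
  have hd : ∀ q ∈ Q, insert a T ∩ q = ∅ := by
    intro q hq
    have := hQ.sub hq
    rw [← Finset.disjoint_iff_inter_eq_empty, Finset.disjoint_left]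
    intro x hx hxq
    have h1 := this hxq
    rw [Finset.mem_sdiff] at h1
    rcases Finset.mem_insert.1 hx with rfl | hx
    · exact ha h1.1
    · exact h1.2 hx
  refine ⟨?_, ?_, ?_⟩
  · intro p hp
    rcases Finset.mem_insert.1 hp with rfl | hp
    · simp
    · exact hQ.1 p hp
  · intro p hp q hq hpq
    rcases Finset.mem_insert.1 hp with rfl | hp <;> rcases Finset.mem_insert.1 hq with rfl | hq
    · exact absurd rfl hpq
    · exact hd q hq
    · rw [Finset.inter_comm]; exact hd p hp
    · exact hQ.2.1 p hp q hq hpq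
  · rw [Finset.sup_insert, hQ.2.2]
    ext x
    simp only [id, Finset.sup_eq_union, Finset.mem_union, Finset.mem_insert, Finset.mem_sdiff]
    constructor
    · rintro ((h | h) | h)
      · exact Or.inl h
      · exact Or.inr (hT h)
      · exact Or.inr h.1
    · rintro (h | h)
      · exact Or.inl (Or.inl h)
      · by_cases hx : x ∈ T
        · exact Or.inl (Or.inr hx)
        · exact Or.inr ⟨h, hx⟩

lemma not_mem_of_setPart {α : Type*} [DecidableEq α] {s T : Finset α} {a : α} (ha : a ∉ s)
    {Q : Finset (Finset α)} (hQ : SetPart (s \ T) Q) : ∀ q ∈ Q, a ∉ q := by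
  intro q hq h
  exact ha (Finset.mem_sdiff.1 (hQ.sub hq h)).1

lemma setPart_erase {α : Type*} [DecidableEq α] {s : Finset α} {a : α} (ha : a ∉ s)
    {P : Finset (Finset α)} (hP : SetPart (insert a s) P) {p : Finset α} (hp : p ∈ P)
    (hap : a ∈ p) : SetPart (s \ p.erase a) (P.erase p) := by
  refine ⟨fun q hq => hP.1 q (Finset.mem_of_mem_erase hq), fun q hq q' hq' h =>
    hP.2.1 q (Finset.mem_of_mem_erase hq) q' (Finset.mem_of_mem_erase hq') h, ?_⟩
  ext x
  simp only [Finset.mem_sup, id, Finset.mem_sdiff, Finset.mem_erase, not_and]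
  constructor
  · rintro ⟨q, ⟨hqp, hq⟩, hx⟩
    have hdis := hP.2.1 q hq p hp hqp
    rw [← Finset.disjoint_iff_inter_eq_empty, Finset.disjoint_left] at hdis
    have hxp := hdis hx
    have hxs := hP.sub hq hx
    refine ⟨?_, fun _ => hxp⟩
    rcases Finset.mem_insert.1 hxs with rfl | h
    · exact absurd hap hxp
    · exact h
  · rintro ⟨hxs, hx⟩
    obtain ⟨q, hq, hxq⟩ := hP.exists_mem (Finset.mem_insert_of_mem hxs)
    refine ⟨q, ⟨?_, hq⟩, hxq⟩
    rintro rfl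
    exact hx (fun h => ha (h ▸ hxs)) hxq

lemma partSum_insert {α : Type*} [DecidableEq α] [Fintype α] (m f : ℕ → ℂ) (s : Finset α) (a : α)
    (ha : a ∉ s) : partSum m f (insert a s) =
      ∑ T ∈ s.powerset, m (T.card + 1) * partSum m (fun j => f (j + 1)) (s \ T) := by
  classical
  unfold partSum
  simp_rw [Finset.mul_sum]
  rw [Finset.sum_sigma']
  symm
  refine Finset.sum_bij (fun x _ => insert (insert a x.1) x.2) ?_ ?_ ?_ ?_
  · rintro ⟨T, Q⟩ h
    simp only [Finset.mem_sigma, Finset.mem_powerset, Finset.mem_filter, Finset.mem_univ,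
      true_and] at h ⊢
    exact setPart_insert ha h.1 h.2
  · rintro ⟨T, Q⟩ h ⟨T', Q'⟩ h' heq
    simp only [Finset.mem_sigma, Finset.mem_powerset, Finset.mem_filter, Finset.mem_univ,
      true_and] at h h' heq
    have n1 := not_mem_of_setPart ha h.2
    have n2 := not_mem_of_setPart ha h'.2
    have e1 : insert a T = insert a T' := by
      have : insert a T ∈ insert (insert a T') Q' := by rw [← heq]; simp
      rcases Finset.mem_insert.1 this with h1 | h1
      · exact h1
      · exact absurd (Finset.mem_insert_self a T) (n2 _ h1)
    have hT : T = T' := by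
      have a1 : a ∉ T := fun h1 => ha (h.1 h1)
      have a2 : a ∉ T' := fun h1 => ha (h'.1 h1)
      rw [← Finset.erase_insert a1, e1, Finset.erase_insert a2]
    subst hT
    have q1 : insert a T ∉ Q := fun h1 => n1 _ h1 (Finset.mem_insert_self a T)
    have q2 : insert a T ∉ Q' := fun h1 => n2 _ h1 (Finset.mem_insert_self a T)
    have : Q = Q' := by
      rw [← Finset.erase_insert q1, heq, Finset.erase_insert q2]
    subst this; rfl
  · intro P hP
    simp only [Finset.mem_filter, Finset.mem_univ, true_and] at hP
    obtain ⟨p, hp, hap⟩ := hP.exists_mem (Finset.mem_insert_self a s)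
    refine ⟨⟨p.erase a, P.erase p⟩, ?_, ?_⟩
    · simp only [Finset.mem_sigma, Finset.mem_powerset, Finset.mem_filter, Finset.mem_univ,
        true_and]
      refine ⟨?_, setPart_erase ha hP hp hap⟩
      intro x hx
      rw [Finset.mem_erase] at hx
      have := hP.sub hp hx.2
      rcases Finset.mem_insert.1 this with h | h
      · exact absurd h hx.1
      · exact h
    · simp only [Finset.insert_erase hap, Finset.insert_erase hp]
  · rintro ⟨T, Q⟩ h
    simp only [Finset.mem_sigma, Finset.mem_powerset, Finset.mem_filter, Finset.mem_univ,
      true_and] at h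
    have n1 := not_mem_of_setPart ha h.2
    have q1 : insert a T ∉ Q := fun h1 => n1 _ h1 (Finset.mem_insert_self a T)
    have a1 : a ∉ T := fun h1 => ha (h.1 h1)
    simp only [Finset.card_insert_of_notMem q1, Finset.prod_insert q1,
      Finset.card_insert_of_notMem a1]
    ring

/-- numeric version of the partition sums -/
noncomputable def numSum (m : ℕ → ℂ) (g : ℕ → ℂ) : ℕ → ℕ → ℂ
  | 0, k => g k
  | n + 1, k => ∑ j : Fin (n + 1), (n.choose j : ℂ) * m (j + 1) * numSum m g (n - j) (k + 1)
termination_by n => n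

lemma partSum_eq {α : Type*} [DecidableEq α] [Fintype α] (m g : ℕ → ℂ) (n : ℕ) :
    ∀ (s : Finset α) (k : ℕ), s.card = n → partSum m (fun j => g (k + j)) s = numSum m g n k := by
  induction n using Nat.strong_induction_on with
  | _ n ih =>
    intro s k hs
    rcases Finset.eq_empty_or_nonempty s with rfl | ⟨a, ha⟩
    · simp at hs; subst hs
      rw [partSum_empty, numSum]; simp
    · obtain ⟨n, rfl⟩ : ∃ n', n = n' + 1 := ⟨n - 1, by
        have := Finset.card_pos.2 ⟨a, ha⟩; omega⟩
      rw [← Finset.insert_erase ha, partSum_insert _ _ _ _ (Finset.notMem_erase a s), numSum]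
      have hc : (s.erase a).card = n := by rw [Finset.card_erase_of_mem ha, hs]; rfl
      set t := s.erase a
      have : ∀ T ∈ t.powerset, m (T.card + 1) * partSum m (fun j => g (k + (j + 1))) (t \ T) =
          m (T.card + 1) * numSum m g (n - T.card) (k + 1) := by
        intro T hT
        rw [Finset.mem_powerset] at hT
        have h2 : (t \ T).card = n - T.card := by rw [Finset.card_sdiff_of_subset hT, hc]
        rw [← ih (n - T.card) (by omega) (t \ T) (k + 1) h2]
        congr 2
        ext j; congr 1; ring
      rw [Finset.sum_congr rfl this, Finset.sum_powerset_apply_card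
        (fun c => m (c + 1) * numSum m g (n - c) (k + 1)), hc, Finset.sum_range]
      refine Finset.sum_congr rfl fun j _ => ?_
      rw [nsmul_eq_mul]; ring

open PowerSeries in
lemma numSum_log (m : ℕ → ℂ) (hm : m 0 = 1) (n : ℕ) :
    m (n + 1) = ∑ j ∈ Finset.range (n + 1), (n.choose j : ℂ) *
      numSum m (fun k => (-1) ^ (k - 1) * ((k - 1).factorial : ℂ)) (j + 1) 0 * m (n - j) := by
  set g : ℕ → ℂ := fun k => (-1) ^ (k - 1) * ((k - 1).factorial : ℂ) with hg
  set M : PowerSeries ℂ := PowerSeries.mk fun n => m n / n.factorial with hM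
  set F : ℕ → PowerSeries ℂ := fun k => PowerSeries.mk fun n => numSum m g n k / n.factorial with hF
  have key : ∀ n j : ℕ, j ≤ n → ((n.choose j : ℂ)) = n.factorial / (j.factorial * (n - j).factorial) := by
    intro n j h
    rw [Nat.cast_choose ℂ h]
  have fne : ∀ n : ℕ, (n.factorial : ℂ) ≠ 0 := fun n => by exact_mod_cast n.factorial_ne_zero
  have dF : ∀ k, PowerSeries.derivative ℂ (F k) = PowerSeries.derivative ℂ M * F (k + 1) := by
    intro k
    ext n
    rw [PowerSeries.coeff_derivative, PowerSeries.coeff_mul,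
      Finset.Nat.sum_antidiagonal_eq_sum_range_succ_mk]
    simp only [hF, hM, PowerSeries.coeff_mk, PowerSeries.coeff_derivative]
    rw [numSum, Finset.sum_fin_eq_sum_range, Finset.sum_div, Finset.sum_mul]
    refine Finset.sum_congr rfl fun j hj => ?_
    rw [Finset.mem_range] at hj
    rw [dif_pos hj]
    simp only []
    rw [key n j (by omega)]
    have h1 := fne n
    have h2 := fne j
    have h3 := fne (n - j)
    have h4 : (n : ℂ) + 1 ≠ 0 := by exact_mod_cast n.succ_ne_zero
    have h5 : (j : ℂ) + 1 ≠ 0 := by exact_mod_cast j.succ_ne_zero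
    rw [Nat.factorial_succ, Nat.factorial_succ]
    push_cast
    field_simp
  set H : ℕ → PowerSeries ℂ := fun k => M * F (k + 1) + (k : PowerSeries ℂ) * F k - (if k = 0 then 1 else 0) with hH
  have dH : ∀ k, PowerSeries.derivative ℂ (H k) = PowerSeries.derivative ℂ M * H (k + 1) := by
    intro k
    have hk : PowerSeries.derivative ℂ (k : PowerSeries ℂ) = 0 := by
      simp
    have hz : PowerSeries.derivative ℂ ((if k = 0 then 1 else 0 : PowerSeries ℂ)) = 0 := by
      split_ifs <;> simp
    simp only [hH, map_add, map_sub, Derivation.leibniz, hz, hk, dF, smul_eq_mul]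
    simp
    ring
  have H0 : ∀ k, PowerSeries.coeff 0 (H k) = 0 := by
    intro k
    have e : ∀ k, numSum m g 0 k = g k := fun k => by rw [numSum]
    rcases k with _ | k
    · simp [hH, hF, hM, hm, e]; simp [hg]
    · simp [hH, hF, hM, hm, e]; simp [hg, Nat.factorial_succ, pow_succ]; ring
  have Hn : ∀ n k, PowerSeries.coeff n (H k) = 0 := by
    intro n
    induction n using Nat.strong_induction_on with
    | _ n ih =>
      intro k
      rcases n with _ | n
      · exact H0 k
      · have := congrArg (PowerSeries.coeff n) (dH k)
        rw [PowerSeries.coeff_derivative, PowerSeries.coeff_mul] at this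
        rw [Finset.sum_eq_zero] at this
        · have h4 : (n : ℂ) + 1 ≠ 0 := by exact_mod_cast n.succ_ne_zero
          simpa [h4] using this
        · rintro ⟨i, j⟩ hij
          have hij := Finset.HasAntidiagonal.mem_antidiagonal.1 hij
          simp only at hij ⊢
          rw [ih j (by omega)]; simp
  have h1 : M * F 1 = 1 := by
    have : H 0 = 0 := by ext n; rw [Hn]; simp
    simp [hH, sub_eq_zero] at this
    exact this
  have fin : PowerSeries.derivative ℂ M = PowerSeries.derivative ℂ (F 0) * M := by
    rw [dF 0, mul_assoc, mul_comm (F (0+1)), zero_add, h1, mul_one]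
  have := congrArg (PowerSeries.coeff n) fin
  rw [PowerSeries.coeff_derivative, PowerSeries.coeff_mul,
      Finset.Nat.sum_antidiagonal_eq_sum_range_succ_mk] at this
  simp only [hF, hM, PowerSeries.coeff_mk, PowerSeries.coeff_derivative] at this
  have h4 : (n : ℂ) + 1 ≠ 0 := by exact_mod_cast n.succ_ne_zero
  have e : m (n + 1) = n.factorial * (m (n + 1) / ((n + 1).factorial : ℂ) * (n + 1)) := by
    rw [Nat.factorial_succ]; push_cast
    have := fne n
    field_simp
  rw [e, this, Finset.mul_sum]
  refine Finset.sum_congr rfl fun j hj => ?_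
  rw [Finset.mem_range] at hj
  rw [key n j (by omega), Nat.factorial_succ]
  have h2 := fne j
  have h3 := fne (n - j)
  have h5 : (j : ℂ) + 1 ≠ 0 := by exact_mod_cast j.succ_ne_zero
  push_cast
  field_simp
end

lemma hasSum_exp_of_rec (m κ : ℕ → ℂ) (hm : m 0 = 1) (κ0 : κ 0 = 0)
    (hrec : ∀ n, m (n + 1) = ∑ j ∈ Finset.range (n + 1), (n.choose j : ℂ) * κ (j + 1) * m (n - j))
    (C : ℝ) (hb : ∀ r, ‖κ r‖ / r.factorial ≤ C * (1 / 2) ^ r) :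
    HasSum (fun r => m r / r.factorial) (Complex.exp (∑' r, κ r / r.factorial)) := by
  set p : FormalMultilinearSeries ℂ ℂ ℂ :=
    FormalMultilinearSeries.ofScalars ℂ (fun r => κ r / (r.factorial : ℂ)) with hp
  have hrad : (2 : ℝ≥0∞) ≤ p.radius := by
    have := p.le_radius_of_bound (r := 2) C (fun n => by
      rw [hp, FormalMultilinearSeries.ofScalars_norm]
      rw [norm_div, Complex.norm_natCast]
      calc ‖κ n‖ / (n.factorial : ℝ) * ((2 : NNReal) : ℝ) ^ n ≤ C * (1 / 2) ^ n * 2 ^ n :=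
            mul_le_mul (hb n) (by norm_num) (by positivity)
              (le_trans (by positivity) (hb n))
        _ = C := by rw [mul_assoc, ← mul_pow]; norm_num)
    exact_mod_cast this
  have hpos : 0 < p.radius := lt_of_lt_of_le (by norm_num) hrad
  have hF0 := (p.hasFPowerSeriesOnBall hpos).mono (r' := 2) (by norm_num) hrad
  set F := p.sum with hFdef
  have hFan : AnalyticOnNhd ℂ F (Metric.ball 0 2) := by
    have := hF0.analyticOnNhd
    rwa [show Metric.eball (0:ℂ) 2 = Metric.ball 0 2 by
      rw [← Metric.eball_ofReal]; simp] at this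
  have hder : ∀ n, iteratedDeriv n F 0 = κ n := by
    intro n
    have h1 := hF0.hasFPowerSeriesAt.eq_formalMultilinearSeries
      (hF0.analyticAt.hasFPowerSeriesAt)
    have h2 := congrArg (fun q => q.coeff n) h1
    have fne : (n.factorial : ℂ) ≠ 0 := by exact_mod_cast n.factorial_ne_zero
    simp only [hp, FormalMultilinearSeries.coeff_ofScalars] at h2
    rw [div_eq_div_iff fne fne] at h2
    exact (mul_right_cancel₀ fne h2).symm
  set G : ℂ → ℂ := fun t => Complex.exp (F t) with hG
  have hGan : AnalyticOnNhd ℂ G (Metric.ball 0 2) := fun x hx => (hFan x hx).cexp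
  have h0 : (0 : ℂ) ∈ Metric.ball (0 : ℂ) 2 := by simp
  have hdG : deriv G =ᶠ[𝓝 0] (deriv F * G) := by
    filter_upwards [Metric.isOpen_ball.mem_nhds h0] with x hx
    have := ((hFan x hx).differentiableAt.hasDerivAt.cexp).deriv
    rw [hG, this]; simp [mul_comm]
  have hmG : ∀ n, iteratedDeriv n G 0 = m n := by
    intro n
    induction n using Nat.strong_induction_on with
    | _ n ih =>
      rcases n with _ | n
      · have : F 0 = 0 := by have := hder 0; rwa [iteratedDeriv_zero, κ0] at this
        simp [hG, this, hm]
      · rw [iteratedDeriv_succ', hdG.iteratedDeriv_eq, iteratedDeriv_mul, hrec]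
        · refine Finset.sum_congr rfl fun j hj => ?_
          rw [← iteratedDeriv_succ', hder, ih (n - j) (by omega)]
        · exact (hFan 0 h0).deriv.contDiffAt
        · exact (hGan 0 h0).contDiffAt
  have h1 : (1 : ℂ) ∈ Metric.ball (0 : ℂ) 2 := by simp
  have := Complex.hasSum_taylorSeries_on_ball (c := 0) (r := 2) (f := G) (by
    simpa using hGan.differentiableOn) (z := 1) (by simpa using h1)
  simp only [hmG, sub_zero, one_pow, smul_eq_mul, mul_one] at this
  have hF1 : F 1 = ∑' r, κ r / r.factorial := by
    rw [hFdef, FormalMultilinearSeries.sum]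
    simp [hp]
  rw [← hF1]
  have e : (fun r => m r / (r.factorial : ℂ)) = fun n => ((n.factorial : ℂ))⁻¹ * (1 * m n) := by
    funext r; rw [one_mul, div_eq_inv_mul]
  rw [e]; exact this

section multilin
variable {Ω : Type*} [MeasurableSpace Ω] {ℙ : Measure Ω} {d : ℕ} {S : Ω → EuclideanSpace ℝ (Fin d)}

lemma list_int (hint : ∀ (r : ℕ) (i : Fin r → Fin d), Integrable (fun ω => ∏ k, S ω (i k)) ℙ)
    (l : List (Fin d)) : Integrable (fun ω => ((l.map (fun i => ((S ω i : ℝ) : ℂ))).prod)) ℙ := by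
  have := (hint l.length l.get).ofReal (𝕜 := ℂ)
  refine this.congr (Eventually.of_forall fun ω => ?_)
  simp only
  rw [← List.prod_ofFn]
  have : (List.ofFn fun k => S ω (l.get k)) = l.map (fun i => S ω i) := by
    apply List.ext_get <;> simp
  rw [this]
  have h := map_list_prod Complex.ofRealHom (l.map (fun i => S ω i))
  rw [List.map_map] at h
  exact h

/-- complex linear form of the random vector -/
def linf (S : Ω → EuclideanSpace ℝ (Fin d)) (v : Fin d → ℂ) (ω : Ω) : ℂ :=
  ∑ i, v i * ((S ω i : ℝ) : ℂ)

lemma prod_linf_int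
    (hint : ∀ (r : ℕ) (i : Fin r → Fin d), Integrable (fun ω => ∏ k, S ω (i k)) ℙ)
    {α : Type*} [DecidableEq α] (v : α → Fin d → ℂ) (p : Finset α) (l : List (Fin d)) :
    Integrable (fun ω => (∏ k ∈ p, linf S (v k) ω) *
      ((l.map (fun i => ((S ω i : ℝ) : ℂ))).prod)) ℙ := by
  induction p using Finset.induction_on generalizing l with
  | empty => simpa using list_int hint l
  | insert a p ha ih =>
    have e : (fun ω => (∏ k ∈ insert a p, linf S (v k) ω) *
      ((l.map (fun i => ((S ω i : ℝ) : ℂ))).prod)) = fun ω => ∑ i, v a i *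
        ((∏ k ∈ p, linf S (v k) ω) * (((i :: l).map (fun i => ((S ω i : ℝ) : ℂ))).prod)) := by
      funext ω
      rw [Finset.prod_insert ha]
      conv_lhs => rw [linf, Finset.sum_mul, Finset.sum_mul]
      refine Finset.sum_congr rfl fun i _ => ?_
      simp only [List.map_cons, List.prod_cons]; ring
    rw [e]
    exact integrable_finsetSum _ fun i _ => (ih (i :: l)).const_mul _

lemma prod_linf_int'
    (hint : ∀ (r : ℕ) (i : Fin r → Fin d), Integrable (fun ω => ∏ k, S ω (i k)) ℙ)
    {α : Type*} [DecidableEq α] (v : α → Fin d → ℂ) (p : Finset α) :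
    Integrable (fun ω => (∏ k ∈ p, linf S (v k) ω)) ℙ := by
  simpa using prod_linf_int hint v p []

/-- joint moment of linear forms over a block -/
def blkM (ℙ : Measure Ω) (S : Ω → EuclideanSpace ℝ (Fin d)) {r : ℕ} (v : Fin r → Fin d → ℂ)
    (p : Finset (Fin r)) : ℂ := ∫ ω, ∏ k ∈ p, linf S (v k) ω ∂ℙ

lemma blkM_notMem {r : ℕ} (v : Fin r → Fin d → ℂ) (p : Finset (Fin r)) (k : Fin r) (hk : k ∉ p)
    (x : Fin d → ℂ) : blkM ℙ S (Function.update v k x) p = blkM ℙ S v p := by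
  unfold blkM
  congr 1; funext ω
  refine Finset.prod_congr rfl fun j hj => ?_
  rw [Function.update_of_ne (show j ≠ k from fun h => hk (h ▸ hj))]

lemma prod_update_linf {r : ℕ} (v : Fin r → Fin d → ℂ) (p : Finset (Fin r)) (k : Fin r) (hk : k ∈ p)
    (x : Fin d → ℂ) (ω : Ω) : ∏ j ∈ p, linf S (Function.update v k x j) ω =
      linf S x ω * ∏ j ∈ p.erase k, linf S (v j) ω := by
  rw [← Finset.mul_prod_erase p _ hk, Function.update_self]
  congr 1
  refine Finset.prod_congr rfl fun j hj => ?_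
  rw [Function.update_of_ne (Finset.ne_of_mem_erase hj)]

lemma blkM_add (hint : ∀ (r : ℕ) (i : Fin r → Fin d), Integrable (fun ω => ∏ k, S ω (i k)) ℙ)
    {r : ℕ} (v : Fin r → Fin d → ℂ) (p : Finset (Fin r)) (k : Fin r) (hk : k ∈ p)
    (x y : Fin d → ℂ) : blkM ℙ S (Function.update v k (x + y)) p =
      blkM ℙ S (Function.update v k x) p + blkM ℙ S (Function.update v k y) p := by
  unfold blkM
  rw [← integral_add (prod_linf_int' hint _ _) (prod_linf_int' hint _ _)]
  congr 1; funext ω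
  simp only [prod_update_linf v p k hk]
  rw [← add_mul]; congr 1
  simp [linf, add_mul, Finset.sum_add_distrib]

lemma blkM_smul 
    {r : ℕ} (v : Fin r → Fin d → ℂ) (p : Finset (Fin r)) (k : Fin r) (hk : k ∈ p)
    (c : ℂ) (x : Fin d → ℂ) : blkM ℙ S (Function.update v k (c • x)) p =
      c * blkM ℙ S (Function.update v k x) p := by
  unfold blkM
  rw [← integral_const_mul]
  congr 1; funext ω
  simp only [prod_update_linf v p k hk]
  rw [← mul_assoc]; congr 1
  simp [linf, Finset.mul_sum, mul_assoc]

/-- product of block moments as a multilinear map -/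
def blkMul (hint : ∀ (r : ℕ) (i : Fin r → Fin d), Integrable (fun ω => ∏ k, S ω (i k)) ℙ)
    {r : ℕ} (P : Finset (Finset (Fin r))) (hP : SetPart Finset.univ P) :
    MultilinearMap ℂ (fun _ : Fin r => Fin d → ℂ) ℂ where
  toFun v := ∏ p ∈ P, blkM ℙ S v p
  map_update_add' := by
    intro inst v k x y
    have : inst = instDecidableEqFin r := Subsingleton.elim _ _
    subst this
    obtain ⟨p, hp, hk⟩ := hP.exists_mem (Finset.mem_univ k)
    have hrest : ∀ x, ∏ q ∈ P.erase p, blkM ℙ S (Function.update v k x) q =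
        ∏ q ∈ P.erase p, blkM ℙ S v q := by
      intro x
      refine Finset.prod_congr rfl fun q hq => blkM_notMem _ _ _ ?_ _
      have hd := hP.2.1 q (Finset.mem_of_mem_erase hq) p hp (Finset.ne_of_mem_erase hq)
      intro hkq
      have : k ∈ q ∩ p := Finset.mem_inter.2 ⟨hkq, hk⟩
      rw [hd] at this; simp at this
    simp only [← Finset.mul_prod_erase P _ hp, hrest]
    rw [blkM_add hint v p k hk, add_mul]
  map_update_smul' := by
    intro inst v k c x
    have : inst = instDecidableEqFin r := Subsingleton.elim _ _
    subst this
    obtain ⟨p, hp, hk⟩ := hP.exists_mem (Finset.mem_univ k)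
    have hrest : ∀ x, ∏ q ∈ P.erase p, blkM ℙ S (Function.update v k x) q =
        ∏ q ∈ P.erase p, blkM ℙ S v q := by
      intro x
      refine Finset.prod_congr rfl fun q hq => blkM_notMem _ _ _ ?_ _
      have hd := hP.2.1 q (Finset.mem_of_mem_erase hq) p hp (Finset.ne_of_mem_erase hq)
      intro hkq
      have : k ∈ q ∩ p := Finset.mem_inter.2 ⟨hkq, hk⟩
      rw [hd] at this; simp at this
    simp only [← Finset.mul_prod_erase P _ hp, hrest]
    rw [blkM_smul v p k hk, smul_eq_mul, mul_assoc]

/-- the cumulant coefficients -/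
def cumCoef (k : ℕ) : ℂ := (-1) ^ (k - 1) * ((k - 1).factorial : ℂ)

/-- complex cumulant of a sequence of moments -/
def cumN (m : ℕ → ℂ) (r : ℕ) : ℂ := numSum m cumCoef r 0

lemma blkMul_expand (hint : ∀ (r : ℕ) (i : Fin r → Fin d), Integrable (fun ω => ∏ k, S ω (i k)) ℙ)
    (z : Fin d → ℂ) {r : ℕ} (P : Finset (Finset (Fin r))) (hP : SetPart Finset.univ P) :
    ∏ p ∈ P, (∫ ω, (linf S z ω) ^ p.card ∂ℙ) = ∑ i : Fin r → Fin d, (∏ k, z (i k)) *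
      ∏ p ∈ P, ((∫ ω, ∏ k ∈ p, S ω (i k) ∂ℙ : ℝ) : ℂ) := by
  have h1 : ∏ p ∈ P, (∫ ω, (linf S z ω) ^ p.card ∂ℙ) = blkMul hint P hP (fun _ => z) := by
    simp only [blkMul, MultilinearMap.coe_mk, blkM, Finset.prod_const]
  have hz : (fun _ : Fin r => z) = fun _ : Fin r => ∑ i, z i • (Pi.single i (1 : ℂ) : Fin d → ℂ) := by
    funext _
    exact pi_eq_sum_univ' z
  rw [h1, hz, MultilinearMap.map_sum]
  refine Finset.sum_congr rfl fun i _ => ?_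
  rw [MultilinearMap.map_smul_univ, smul_eq_mul]
  congr 1
  simp only [blkMul, MultilinearMap.coe_mk, blkM]
  refine Finset.prod_congr rfl fun p _ => ?_
  rw [← integral_complex_ofReal]
  congr 1; funext ω
  push_cast
  refine Finset.prod_congr rfl fun k _ => ?_
  simp [linf, Pi.single_apply]

lemma cumN_eq (hint : ∀ (r : ℕ) (i : Fin r → Fin d), Integrable (fun ω => ∏ k, S ω (i k)) ℙ)
    (z : Fin d → ℂ) (r : ℕ) :
    cumN (fun r => ∫ ω, (linf S z ω) ^ r ∂ℙ) r = ∑ i : Fin r → Fin d, (∏ k, z (i k)) *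
      ((jointCumulant ℙ (fun k ω => S ω (i k)) : ℝ) : ℂ) := by
  classical
  have h := partSum_eq (α := Fin r) (fun r => ∫ ω, (linf S z ω) ^ r ∂ℙ) cumCoef r Finset.univ 0
    (by simp)
  rw [cumN, ← h]
  simp only [zero_add]
  unfold partSum jointCumulant
  push_cast
  simp_rw [Finset.mul_sum]
  rw [Finset.sum_comm]
  refine Finset.sum_congr (by
    ext P
    exact ⟨fun h => Finset.mem_filter.2 ⟨Finset.mem_univ _, (Finset.mem_filter.1 h).2⟩,
      fun h => Finset.mem_filter.2 ⟨Finset.mem_univ _, (Finset.mem_filter.1 h).2⟩⟩) fun P hP => ?_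
  simp only [Finset.mem_filter, Finset.mem_univ, true_and] at hP
  rw [blkMul_expand hint z P hP, Finset.mul_sum]
  refine Finset.sum_congr rfl fun i _ => ?_
  rw [cumCoef]
  ring

end multilin

section expo
variable {Ω : Type*} [MeasurableSpace Ω] {ℙ : Measure Ω}

lemma laplace_hasSum (X : Ω → ℂ) (hint : ∀ r : ℕ, Integrable (fun ω => X ω ^ r) ℙ)
    (hexp : Integrable (fun ω => Real.exp ‖X ω‖) ℙ) :
    HasSum (fun r : ℕ => (∫ ω, X ω ^ r ∂ℙ) / r.factorial) (∫ ω, Complex.exp (X ω) ∂ℙ) := by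
  have h := hasSum_integral_of_summable_integral_norm (μ := ℙ)
    (F := fun (r : ℕ) ω => X ω ^ r / (r.factorial : ℂ)) (fun r => (hint r).div_const _) (by
      refine summable_of_sum_le (c := ∫ ω, Real.exp ‖X ω‖ ∂ℙ) (fun r => ?_) (fun u => ?_)
      · exact integral_nonneg fun _ => norm_nonneg _
      · rw [← integral_finsetSum _ (fun r _ => ((hint r).div_const _).norm)]
        refine integral_mono (integrable_finsetSum _ (fun r _ => ((hint r).div_const _).norm)) hexp ?_
        intro ω
        simp only [norm_div, norm_pow, Complex.norm_natCast]
        have := NormedSpace.expSeries_div_hasSum_exp (𝔸 := ℝ) (‖X ω‖)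
        rw [← Real.exp_eq_exp_ℝ] at this
        exact sum_le_hasSum u (fun i _ => by positivity) this)
  simp only [integral_div] at h
  have := fun ω => (NormedSpace.expSeries_div_hasSum_exp (𝔸 := ℂ) (X ω)).tsum_eq
  simp_rw [this, ← Complex.exp_eq_exp_ℂ] at h
  exact h

lemma cosh_int (X : Ω → ℝ) (hint : ∀ r : ℕ, Integrable (fun ω => X ω ^ r) ℙ)
    (hs : Summable (fun r : ℕ => (∫ ω, X ω ^ r ∂ℙ) / r.factorial)) :
    Integrable (fun ω => Real.cosh (X ω)) ℙ := by
  have hX : AEMeasurable X ℙ := by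
    have := (hint 1).aemeasurable
    simpa using this
  have hm : AEStronglyMeasurable (fun ω => Real.cosh (X ω)) ℙ :=
    (Real.measurable_cosh.comp_aemeasurable hX).aestronglyMeasurable
  refine ⟨hm, ?_⟩
  rw [hasFiniteIntegral_iff_ofReal (Eventually.of_forall fun ω => (Real.cosh_pos _).le)]
  have hk : ∀ k : ℕ, Integrable (fun ω => X ω ^ (2 * k) / ((2 * k).factorial : ℝ)) ℙ :=
    fun k => (hint _).div_const _
  have hnn : ∀ (k : ℕ) ω, 0 ≤ X ω ^ (2 * k) / ((2 * k).factorial : ℝ) := fun k ω => by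
    have : 0 ≤ X ω ^ (2 * k) := by rw [pow_mul]; positivity
    positivity
  have e : ∀ ω, ENNReal.ofReal (Real.cosh (X ω)) =
      ∑' k : ℕ, ENNReal.ofReal (X ω ^ (2 * k) / ((2 * k).factorial : ℝ)) := by
    intro ω
    have := Real.hasSum_cosh (X ω)
    rw [← this.tsum_eq, ENNReal.ofReal_tsum_of_nonneg (fun k => hnn k ω) this.summable]
  simp_rw [e]
  rw [lintegral_tsum (fun k => (hk k).aemeasurable.ennreal_ofReal)]
  have e2 : ∀ k : ℕ, ∫⁻ ω, ENNReal.ofReal (X ω ^ (2 * k) / ((2 * k).factorial : ℝ)) ∂ℙ =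
      ENNReal.ofReal ((∫ ω, X ω ^ (2 * k) ∂ℙ) / ((2 * k).factorial : ℝ)) := by
    intro k
    rw [← ofReal_integral_eq_lintegral_ofReal (hk k) (Eventually.of_forall (hnn k)), integral_div]
  simp_rw [e2]
  have hs2 : Summable (fun k : ℕ => (∫ ω, X ω ^ (2 * k) ∂ℙ) / ((2 * k).factorial : ℝ)) :=
    hs.comp_injective (i := fun k => 2 * k) (fun a b h => by simpa using h)
  exact hs2.tsum_ofReal_lt_top

end expo

section lap
variable {Ω : Type*} [MeasurableSpace Ω] {ℙ : Measure Ω} [IsProbabilityMeasure ℙ]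
  {d : ℕ} {S : Ω → EuclideanSpace ℝ (Fin d)}

lemma pow_fact_le (r : ℕ) : (r : ℝ) ^ (r - 2) / r.factorial ≤ Real.exp 1 ^ r := by
  have h1 : (r : ℝ) ^ r / r.factorial ≤ Real.exp r :=
    Real.pow_div_factorial_le_exp (r : ℝ) (by positivity) r
  rw [← Real.exp_nat_mul, mul_one]
  refine le_trans ?_ h1
  rcases Nat.eq_zero_or_pos r with rfl | h
  · simp
  gcongr
  · exact_mod_cast h
  · omega

lemma cum_zero (hint : ∀ (r : ℕ) (i : Fin r → Fin d), Integrable (fun ω => ∏ k, S ω (i k)) ℙ)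
    (z : Fin d → ℂ) :
    ∀ n, (∫ ω, linf S z ω ^ (n + 1) ∂ℙ) = ∑ j ∈ Finset.range (n + 1), (n.choose j : ℂ) *
      cumN (fun r => ∫ ω, (linf S z ω) ^ r ∂ℙ) (j + 1) * (∫ ω, linf S z ω ^ (n - j) ∂ℙ) := by
  intro n
  exact numSum_log (fun r => ∫ ω, (linf S z ω) ^ r ∂ℙ) (by simp) n

/-- Abstract form of the cumulant estimate: cumulants of `linf S z` bounded. -/
lemma lap_sum (hint : ∀ (r : ℕ) (i : Fin r → Fin d), Integrable (fun ω => ∏ k, S ω (i k)) ℙ)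
    (z : Fin d → ℂ) (ε ρ : ℝ) (hε : 0 < ε) (hρ0 : 0 ≤ ρ) (hρ : ρ ≤ 1 / 2)
    (h1 : cumN (fun r => ∫ ω, (linf S z ω) ^ r ∂ℙ) 1 = 0)
    (hc : ∀ r : ℕ, 3 ≤ r → ‖cumN (fun r => ∫ ω, (linf S z ω) ^ r ∂ℙ) r‖ / r.factorial ≤
      (ε ^ 2)⁻¹ * ρ ^ r / 2) :
    ∃ R : ℂ, ‖R‖ ≤ (ε ^ 2)⁻¹ * ρ ^ 3 ∧
      HasSum (fun r : ℕ => (∫ ω, linf S z ω ^ r ∂ℙ) / (r.factorial : ℂ))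
        (Complex.exp (cumN (fun r => ∫ ω, (linf S z ω) ^ r ∂ℙ) 2 / 2 + R)) := by
  set c : ℕ → ℂ := cumN (fun r => ∫ ω, (linf S z ω) ^ r ∂ℙ) with hcdef
  set κ : ℕ → ℂ := fun r => if r = 0 then 0 else c r with hκ
  have hκ3 : ∀ r, 3 ≤ r → ‖κ r‖ / r.factorial ≤ (ε ^ 2)⁻¹ * ρ ^ r / 2 := by
    intro r hr
    simp only [hκ, if_neg (show r ≠ 0 by omega)]
    exact hc r hr
  have hb : ∀ r, ‖κ r‖ / r.factorial ≤ ((ε ^ 2)⁻¹ + 4 * ‖c 2‖) * (1 / 2) ^ r := by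
    intro r
    have e2 : 0 ≤ (ε ^ 2)⁻¹ := by positivity
    rcases r with _ | _ | _ | r
    · simp [hκ]; positivity
    · simp [hκ, h1]; positivity
    · simp [hκ]
      nlinarith [norm_nonneg (c 2)]
    · refine (hκ3 _ (by omega)).trans ?_
      have : ρ ^ (r + 3) ≤ (1 / 2) ^ (r + 3) := by gcongr
      calc (ε ^ 2)⁻¹ * ρ ^ (r + 3) / 2 ≤ (ε ^ 2)⁻¹ * ρ ^ (r + 3) := by
            have : 0 ≤ (ε ^ 2)⁻¹ * ρ ^ (r + 3) := by positivity
            linarith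
        _ ≤ (ε ^ 2)⁻¹ * (1 / 2) ^ (r + 3) := by gcongr
        _ ≤ _ := by gcongr; linarith [norm_nonneg (c 2)]
  have hsum := hasSum_exp_of_rec (fun r => ∫ ω, (linf S z ω) ^ r ∂ℙ) κ (by simp) (by simp [hκ])
    (by
      intro n
      rw [cum_zero hint z n]
      simp [hκ, hcdef]) _ hb
  have hsm : Summable (fun r => κ r / (r.factorial : ℂ)) := by
    refine Summable.of_norm_bounded (g := fun r => ((ε ^ 2)⁻¹ + 4 * ‖c 2‖) * (1 / 2) ^ r) ?_ ?_
    · exact (summable_geometric_two).mul_left _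
    · intro r; rw [norm_div, Complex.norm_natCast]; exact hb r
  refine ⟨∑' r, κ (r + 3) / ((r + 3).factorial : ℂ), ?_, ?_⟩
  · have hg : HasSum (fun r : ℕ => (ε ^ 2)⁻¹ * ρ ^ 3 / 2 * (1 / 2) ^ r) ((ε ^ 2)⁻¹ * ρ ^ 3 / 2 * 2) :=
      hasSum_geometric_two.mul_left _
    have := tsum_of_norm_bounded hg (f := fun r => κ (r + 3) / ((r + 3).factorial : ℂ)) (by
      intro r
      rw [norm_div, Complex.norm_natCast]
      refine (hκ3 _ (by omega)).trans ?_
      rw [pow_add]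
      have : ρ ^ r ≤ (1 / 2) ^ r := by gcongr
      calc (ε ^ 2)⁻¹ * (ρ ^ r * ρ ^ 3) / 2 = (ε ^ 2)⁻¹ * ρ ^ 3 / 2 * ρ ^ r := by ring
        _ ≤ _ := by gcongr)
    linarith
  · have := hsm.sum_add_tsum_nat_add 3
    rw [← this] at hsum
    convert hsum using 2
    simp [Finset.sum_range_succ, hκ, h1]


/-- The hypotheses at a fixed index. -/
structure MCHyp (K : Matrix (Fin d) (Fin d) ℝ) (A B : ℝ) (ℙ : Measure Ω)
    (S : Ω → EuclideanSpace ℝ (Fin d)) (N D : ℝ) : Prop where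
  meas : Measurable S
  hN : 0 < N
  hD : 0 < D
  hint : ∀ (r : ℕ) (i : Fin r → Fin d), Integrable (fun ω => ∏ k, S ω (i k)) ℙ
  mean : ∀ i, ∫ ω, S ω i ∂ℙ = 0
  cov : ∀ i j : Fin d, ∃ δ : ℝ, |δ| ≤ B * Real.sqrt (D / N) ∧
    jointCumulant ℙ ![fun ω => S ω i, fun ω => S ω j] = N * D * K i j * (1 + δ)
  mc3 : ∀ (r : ℕ), 3 ≤ r → ∀ i : Fin r → Fin d,
        |jointCumulant ℙ (fun k ω => S ω (i k))| ≤
          N * (2 * D) ^ (r - 1) * A ^ r * (r : ℝ) ^ (r - 2)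

/-- the scaling identity -/
lemma scale_id {N D : ℝ} (hN : 0 < N) (hD : 0 < D) :
    (Real.sqrt (N * D))⁻¹ = Real.sqrt (D / N) / D ∧ N = D / (Real.sqrt (D / N)) ^ 2 := by
  have h2 : Real.sqrt (D / N) ^ 2 = D / N := Real.sq_sqrt (by positivity)
  constructor
  · rw [eq_div_iff hD.ne', inv_mul_eq_iff_eq_mul₀ (by positivity), ← Real.sqrt_mul (by positivity)]
    rw [show N * D * (D / N) = D ^ 2 by field_simp, Real.sqrt_sq hD.le]
  · rw [h2]; field_simp

lemma cum_bound {K : Matrix (Fin d) (Fin d) ℝ} {A B : ℝ} {N D : ℝ} (hA : 0 < A)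
    (H : MCHyp K A B ℙ S N D) (z : Fin d → ℂ) (r : ℕ) (hr : 3 ≤ r) :
    ‖cumN (fun r => ∫ ω, (linf S (fun i => ((Real.sqrt (N * D))⁻¹ : ℝ) * z i) ω) ^ r ∂ℙ) r‖ / r.factorial
      ≤ ((Real.sqrt (D / N)) ^ 2)⁻¹ *
        (2 * A * Real.exp 1 * (∑ i, ‖z i‖) * Real.sqrt (D / N)) ^ r / 2 := by
  obtain ⟨s1, s2⟩ := scale_id H.hN H.hD
  have hN := H.hN
  have hD := H.hD
  have hε : 0 < Real.sqrt (D / N) := Real.sqrt_pos.2 (by positivity)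
  rw [cumN_eq H.hint]
  set ε := Real.sqrt (D / N)
  set a := (Real.sqrt (N * D))⁻¹
  set q := ∑ i, ‖z i‖
  have hq : 0 ≤ q := Finset.sum_nonneg fun _ _ => norm_nonneg _
  have ha : 0 < a := by rw [s1]; positivity
  have h1 : ‖∑ i : Fin r → Fin d, (∏ k, ((a : ℝ) : ℂ) * z (i k)) *
      ((jointCumulant ℙ (fun k ω => S ω (i k)) : ℝ) : ℂ)‖ ≤
      (a * q) ^ r * (N * (2 * D) ^ (r - 1) * A ^ r * (r : ℝ) ^ (r - 2)) := by
    refine (norm_sum_le _ _).trans ?_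
    rw [show (a * q) = ∑ i, a * ‖z i‖ from Finset.mul_sum _ _ _, Fintype.sum_pow, Finset.sum_mul]
    refine Finset.sum_le_sum fun i _ => ?_
    rw [norm_mul, norm_prod, Complex.norm_real, Real.norm_eq_abs]
    refine mul_le_mul ?_ (H.mc3 r hr i) (abs_nonneg _) ?_
    · refine le_of_eq (Finset.prod_congr rfl fun k _ => ?_)
      rw [norm_mul, Complex.norm_real, Real.norm_of_nonneg ha.le]
    · exact Finset.prod_nonneg fun _ _ => by positivity
  have h2 := pow_fact_le r
  calc _ ≤ (a * q) ^ r * (N * (2 * D) ^ (r - 1) * A ^ r * (r : ℝ) ^ (r - 2)) / r.factorial := by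
        gcongr
    _ = (a * q) ^ r * (N * (2 * D) ^ (r - 1) * A ^ r) * ((r : ℝ) ^ (r - 2) / r.factorial) := by ring
    _ ≤ (a * q) ^ r * (N * (2 * D) ^ (r - 1) * A ^ r) * Real.exp 1 ^ r := by gcongr
    _ = _ := by
      obtain ⟨t, rfl⟩ : ∃ t, r = t + 1 := ⟨r - 1, by omega⟩
      simp only [Nat.add_sub_cancel]
      rw [s1, s2]
      simp only [mul_pow, div_pow, pow_succ]
      field_simp

lemma linf_smul (S : Ω → EuclideanSpace ℝ (Fin d)) (c : ℂ) (z : Fin d → ℂ) (ω : Ω) :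
    linf S (fun i => c * z i) ω = c * linf S z ω := by
  simp [linf, Finset.mul_sum, mul_assoc]

lemma S_int (hint : ∀ (r : ℕ) (i : Fin r → Fin d), Integrable (fun ω => ∏ k, S ω (i k)) ℙ)
    (i : Fin d) : Integrable (fun ω => S ω i) ℙ := by
  have := hint 1 (fun _ => i)
  simpa using this

lemma cum_one {K : Matrix (Fin d) (Fin d) ℝ} {A B : ℝ} {N D : ℝ}
    (H : MCHyp K A B ℙ S N D) (z : Fin d → ℂ) :
    cumN (fun r => ∫ ω, (linf S z ω) ^ r ∂ℙ) 1 = 0 := by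
  have := cum_zero H.hint z 0
  simp at this
  rw [← this]
  unfold linf
  rw [integral_finsetSum _ (fun i _ => ((S_int H.hint i).ofReal).const_mul _)]
  refine Finset.sum_eq_zero fun i _ => ?_
  rw [integral_const_mul, integral_complex_ofReal, H.mean i]; simp

lemma cum_two {K : Matrix (Fin d) (Fin d) ℝ} {A B : ℝ} {N D : ℝ}
    (H : MCHyp K A B ℙ S N D) (z : Fin d → ℂ) :
    ‖cumN (fun r => ∫ ω, (linf S (fun i => ((Real.sqrt (N * D))⁻¹ : ℝ) * z i) ω) ^ r ∂ℙ) 2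
      - ∑ i, ∑ j, z i * z j * (K i j : ℂ)‖ ≤ B * Real.sqrt (D / N) * (∑ i, ‖z i‖) ^ 2 *
        (∑ i, ∑ j, |K i j|) := by
  obtain ⟨s1, s2⟩ := scale_id H.hN H.hD
  have hN := H.hN
  have hD := H.hD
  have ha2 : ((Real.sqrt (N * D))⁻¹) ^ 2 * (N * D) = 1 := by
    rw [inv_pow, Real.sq_sqrt (by positivity)]; field_simp
  choose δ hδ hcov using H.cov
  rw [cumN_eq H.hint]
  set ε := Real.sqrt (D / N)
  set a := (Real.sqrt (N * D))⁻¹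
  set q := ∑ i, ‖z i‖
  have e1 : ∑ i : Fin 2 → Fin d, (∏ k, ((a : ℝ) : ℂ) * z (i k)) *
      ((jointCumulant ℙ (fun k ω => S ω (i k)) : ℝ) : ℂ) =
      ∑ i, ∑ j, z i * z j * ((K i j * (1 + δ i j) : ℝ) : ℂ) := by
    rw [← (finTwoArrowEquiv (Fin d)).symm.sum_comp, Fintype.sum_prod_type]
    refine Finset.sum_congr rfl fun i _ => Finset.sum_congr rfl fun j _ => ?_
    have : (fun (k : Fin 2) ω => S ω ((finTwoArrowEquiv (Fin d)).symm (i, j) k)) =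
        ![fun ω => S ω i, fun ω => S ω j] := by
      funext k; fin_cases k <;> simp
    rw [this, hcov]
    simp only [Fin.prod_univ_two, finTwoArrowEquiv_symm_apply, Matrix.cons_val_zero, Matrix.cons_val_one]
    have h3 : ((a : ℝ) : ℂ) ^ 2 * ((N : ℂ) * D) = 1 := by exact_mod_cast ha2
    push_cast
    linear_combination (z i * z j * (K i j * (1 + δ i j))) * h3
  rw [e1, ← Finset.sum_sub_distrib]
  simp_rw [← Finset.sum_sub_distrib]
  refine (norm_sum_le _ _).trans ?_
  rw [Finset.mul_sum]
  refine Finset.sum_le_sum fun i _ => (norm_sum_le _ _).trans ?_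
  rw [Finset.mul_sum]
  refine Finset.sum_le_sum fun j _ => ?_
  have hzi : ∀ i, ‖z i‖ ≤ q := fun i =>
    Finset.single_le_sum (f := fun i => ‖z i‖) (fun _ _ => norm_nonneg _) (Finset.mem_univ i)
  have e3 : z i * z j * ((K i j * (1 + δ i j) : ℝ) : ℂ) - z i * z j * (K i j : ℂ) =
      (δ i j : ℂ) * (z i * z j) * (K i j : ℂ) := by push_cast; ring
  rw [e3, norm_mul, norm_mul, norm_mul, Complex.norm_real, Complex.norm_real, Real.norm_eq_abs,
    Real.norm_eq_abs, sq]
  have hq : 0 ≤ q := Finset.sum_nonneg fun _ _ => norm_nonneg _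
  have hBε : 0 ≤ B * ε := (abs_nonneg _).trans (hδ i j)
  gcongr
  · exact hδ i j
  · exact hzi i
  · exact hzi j

/-- Real exponential moments. -/
lemma real_cosh_int {K : Matrix (Fin d) (Fin d) ℝ} {A B : ℝ} {N D : ℝ} (hA : 0 < A)
    (H : MCHyp K A B ℙ S N D) (x : Fin d → ℝ)
    (hx : 4 * A * Real.exp 1 * (∑ i, |x i|) * Real.sqrt (D / N) ≤ 1) :
    Integrable (fun ω => Real.cosh ((Real.sqrt (N * D))⁻¹ * ∑ i, x i * S ω i)) ℙ := by
  have hN := H.hN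
  have hD := H.hD
  have hε : 0 < Real.sqrt (D / N) := Real.sqrt_pos.2 (by positivity)
  set X : Ω → ℝ := fun ω => (Real.sqrt (N * D))⁻¹ * ∑ i, x i * S ω i with hX
  have hlin : ∀ ω, linf S (fun i => ((Real.sqrt (N * D))⁻¹ : ℝ) * ((x i : ℝ) : ℂ)) ω = (X ω : ℂ) := by
    intro ω
    rw [linf_smul, hX]; simp [linf]
  obtain ⟨R, -, hs⟩ := lap_sum H.hint (fun i => ((Real.sqrt (N * D))⁻¹ : ℝ) * ((x i : ℝ) : ℂ))
    (Real.sqrt (D / N)) (2 * A * Real.exp 1 * (∑ i, ‖((x i : ℝ) : ℂ)‖) * Real.sqrt (D / N)) hε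
    (by positivity) (by simp only [Complex.norm_real, Real.norm_eq_abs]; linarith) (cum_one H _)
    (fun r hr => cum_bound hA H _ r hr)
  have hint : ∀ r : ℕ, Integrable (fun ω => X ω ^ r) ℙ := by
    intro r
    have := prod_linf_int' H.hint (fun _ : Fin r => (fun i =>
      ((Real.sqrt (N * D))⁻¹ : ℝ) * ((x i : ℝ) : ℂ))) Finset.univ
    simp only [hlin, Finset.prod_const, Finset.card_univ, Fintype.card_fin] at this
    have h2 := this.re
    refine h2.congr (Eventually.of_forall fun ω => ?_)
    show ((X ω : ℂ) ^ r).re = X ω ^ r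
    rw [← Complex.ofReal_pow]
    exact Complex.ofReal_re _
  refine cosh_int X hint ?_
  have := hs.summable
  simp only [hlin] at this
  rw [← Complex.summable_ofReal]
  refine this.congr fun r => ?_
  push_cast
  rw [← integral_complex_ofReal]
  simp

lemma exp_norm_int {K : Matrix (Fin d) (Fin d) ℝ} {A B : ℝ} {N D : ℝ} (hA : 0 < A)
    (H : MCHyp K A B ℙ S N D) (z : Fin d → ℂ)
    (hz : 8 * A * Real.exp 1 * (∑ i, ‖z i‖) * Real.sqrt (D / N) ≤ 1) :
    Integrable (fun ω => Real.exp ‖linf S (fun i => ((Real.sqrt (N * D))⁻¹ : ℝ) * z i) ω‖) ℙ := by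
  have hmeas : Measurable (fun ω => linf S (fun i => ((Real.sqrt (N * D))⁻¹ : ℝ) * z i) ω) := by
    unfold linf
    have := H.meas
    have h2 : ∀ i, Measurable (fun ω => S ω i) := fun i => by fun_prop
    fun_prop
  have hb : ∀ x : Fin d → ℝ, (∀ i, |x i| ≤ ‖z i‖) →
      4 * A * Real.exp 1 * (∑ i, |2 * x i|) * Real.sqrt (D / N) ≤ 1 := by
    intro x hx
    refine le_trans ?_ hz
    have : ∑ i, |2 * x i| ≤ 2 * ∑ i, ‖z i‖ := by
      rw [Finset.mul_sum]
      refine Finset.sum_le_sum fun i _ => ?_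
      rw [abs_mul, abs_two]; linarith [hx i]
    calc _ ≤ 4 * A * Real.exp 1 * (2 * ∑ i, ‖z i‖) * Real.sqrt (D / N) := by gcongr
      _ = _ := by ring
  have i1 := real_cosh_int hA H (fun i => 2 * (z i).re) (hb _ fun i => Complex.abs_re_le_norm _)
  have i2 := real_cosh_int hA H (fun i => 2 * (z i).im) (hb _ fun i => Complex.abs_im_le_norm _)
  refine (i1.add i2).mono' (Real.measurable_exp.comp hmeas.norm).aestronglyMeasurable
    (Eventually.of_forall fun ω => ?_)
  rw [Real.norm_of_nonneg (Real.exp_pos _).le]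
  set X := linf S (fun i => ((Real.sqrt (N * D))⁻¹ : ℝ) * z i) ω with hX
  have hre : (Real.sqrt (N * D))⁻¹ * ∑ i, 2 * (z i).re * S ω i = 2 * X.re := by
    rw [hX, linf_smul, Complex.re_ofReal_mul, linf, Complex.re_sum]
    simp only [Complex.mul_re, Complex.ofReal_re, Complex.ofReal_im, mul_zero, sub_zero,
      Finset.mul_sum]
    refine Finset.sum_congr rfl fun i _ => by ring
  have him : (Real.sqrt (N * D))⁻¹ * ∑ i, 2 * (z i).im * S ω i = 2 * X.im := by
    rw [hX, linf_smul, Complex.im_ofReal_mul, linf, Complex.im_sum]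
    simp only [Complex.mul_im, Complex.ofReal_re, Complex.ofReal_im, mul_zero, zero_add,
      Finset.mul_sum]
    refine Finset.sum_congr rfl fun i _ => by ring
  simp only [Pi.add_apply]
  rw [hre, him]
  have h1 : ‖X‖ ≤ |X.re| + |X.im| := Complex.norm_le_abs_re_add_abs_im X
  rw [← Real.cosh_abs (2 * X.re), ← Real.cosh_abs (2 * X.im), abs_mul, abs_mul, abs_two,
    Real.cosh_eq, Real.cosh_eq]
  have h3 : Real.exp ‖X‖ ≤ Real.exp |X.re| * Real.exp |X.im| := by
    rw [← Real.exp_add]; exact Real.exp_le_exp.2 h1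
  have e1 : Real.exp (2 * |X.re|) = Real.exp |X.re| ^ 2 := by rw [← Real.exp_nat_mul]; norm_num
  have e2 : Real.exp (2 * |X.im|) = Real.exp |X.im| ^ 2 := by rw [← Real.exp_nat_mul]; norm_num
  have p1 := Real.exp_pos (-(2 * |X.re|))
  have p2 := Real.exp_pos (-(2 * |X.im|))
  nlinarith [sq_nonneg (Real.exp |X.re| - Real.exp |X.im|)]

/-- The Laplace transform of the normalized vector. -/
lemma laplace_main {K : Matrix (Fin d) (Fin d) ℝ} {A B : ℝ} {N D : ℝ} (hA : 0 < A)
    (H : MCHyp K A B ℙ S N D) (z : Fin d → ℂ)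
    (hz : 8 * A * Real.exp 1 * (∑ i, ‖z i‖) * Real.sqrt (D / N) ≤ 1) :
    ∃ R : ℂ, ‖R‖ ≤ (B * (∑ i, ∑ j, |K i j|) * (∑ i, ‖z i‖) ^ 2 +
        (2 * A * Real.exp 1) ^ 3 * (∑ i, ‖z i‖) ^ 3) * Real.sqrt (D / N) ∧
      ∫ ω, Complex.exp (linf S (fun i => ((Real.sqrt (N * D))⁻¹ : ℝ) * z i) ω) ∂ℙ =
        Complex.exp ((∑ i, ∑ j, z i * z j * (K i j : ℂ)) / 2 + R) := by
  have hN := H.hN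
  have hD := H.hD
  have hε : 0 < Real.sqrt (D / N) := Real.sqrt_pos.2 (by positivity)
  set q := ∑ i, ‖z i‖ with hq
  have hq0 : 0 ≤ q := Finset.sum_nonneg fun _ _ => norm_nonneg _
  obtain ⟨R, hR, hs⟩ := lap_sum H.hint (fun i => ((Real.sqrt (N * D))⁻¹ : ℝ) * z i)
    (Real.sqrt (D / N)) (2 * A * Real.exp 1 * q * Real.sqrt (D / N)) hε
    (by positivity) (by
      have : 0 ≤ A * Real.exp 1 * q * Real.sqrt (D / N) := by positivity
      linarith) (cum_one H _)
    (fun r hr => cum_bound hA H _ r hr)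
  have hint : ∀ r : ℕ, Integrable (fun ω =>
      linf S (fun i => ((Real.sqrt (N * D))⁻¹ : ℝ) * z i) ω ^ r) ℙ := by
    intro r
    have := prod_linf_int' H.hint (fun _ : Fin r => (fun i =>
      ((Real.sqrt (N * D))⁻¹ : ℝ) * z i)) Finset.univ
    simpa only [Finset.prod_const, Finset.card_univ, Fintype.card_fin] using this
  have h2 := laplace_hasSum _ hint (exp_norm_int hA H z hz)
  have heq := h2.unique hs
  have hc2 := cum_two H z
  set c2 := cumN (fun r => ∫ ω, (linf S (fun i => ((Real.sqrt (N * D))⁻¹ : ℝ) * z i) ω) ^ r ∂ℙ) 2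
  set Q := ∑ i, ∑ j, z i * z j * (K i j : ℂ)
  refine ⟨(c2 - Q) / 2 + R, ?_, ?_⟩
  · refine (norm_add_le _ _).trans ?_
    rw [norm_div, Complex.norm_ofNat]
    have e : ((Real.sqrt (D / N)) ^ 2)⁻¹ * (2 * A * Real.exp 1 * q * Real.sqrt (D / N)) ^ 3 =
        (2 * A * Real.exp 1) ^ 3 * q ^ 3 * Real.sqrt (D / N) := by
      field_simp
    rw [e] at hR
    have := norm_nonneg (c2 - Q)
    calc _ ≤ ‖c2 - Q‖ + ‖R‖ := by linarith
      _ ≤ _ := by linarith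
  · rw [heq]; congr 1; ring

end lap

section gauss
variable {d : ℕ} {K : Matrix (Fin d) (Fin d) ℝ}

open scoped MatrixOrder in
lemma exists_sqrt_mat (hK : K.PosDef) :
    ∃ M : Matrix (Fin d) (Fin d) ℝ, K = M * M.transpose ∧ M.det ≠ 0 := by
  have h0 : 0 ≤ K := Matrix.nonneg_iff_posSemidef.2 hK.posSemidef
  obtain ⟨B, hB⟩ := (CStarAlgebra.nonneg_iff_eq_star_mul_self).1 h0
  refine ⟨B.transpose, ?_, ?_⟩
  · rw [hB, Matrix.transpose_transpose, Matrix.star_eq_conjTranspose,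
      Matrix.conjTranspose_eq_transpose_of_trivial]
  · intro h
    have := hK.det_pos
    rw [hB, Matrix.det_mul, ← Matrix.det_transpose B, h] at this
    simp at this

/-- the linear change of variables -/
def linT (M : Matrix (Fin d) (Fin d) ℝ) (v : Fin d → ℝ) : EuclideanSpace ℝ (Fin d) :=
  WithLp.toLp 2 (Matrix.toLin' M v)

lemma linT_apply (M : Matrix (Fin d) (Fin d) ℝ) (v : Fin d → ℝ) (i : Fin d) :
    linT M v i = ∑ j, M i j * v j := by
  simp [linT, Matrix.mulVec, dotProduct]

lemma linT_emb {M : Matrix (Fin d) (Fin d) ℝ} (hM : M.det ≠ 0) :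
    MeasurableEmbedding (linT M) := by
  have h1 : MeasurableEmbedding (Matrix.toLin' M) := by
    have : Function.Injective (Matrix.toLin' M) := by
      rw [Matrix.toLin'_apply']
      exact Matrix.mulVec_injective_iff_isUnit.2 ((Matrix.isUnit_iff_isUnit_det _).2 hM.isUnit)
    exact (LinearMap.continuous_of_finiteDimensional _).measurableEmbedding this
  exact (MeasurableEquiv.toLp 2 (Fin d → ℝ)).measurableEmbedding.comp h1

lemma linT_map {M : Matrix (Fin d) (Fin d) ℝ} (hM : M.det ≠ 0) :
    Measure.map (linT M) volume = ENNReal.ofReal |M.det⁻¹| • volume := by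
  have h2 := (PiLp.volume_preserving_toLp (Fin d))
  have : linT M = (WithLp.toLp 2 : (Fin d → ℝ) → EuclideanSpace ℝ (Fin d)) ∘ Matrix.toLin' M := rfl
  rw [this, ← Measure.map_map h2.measurable
    (LinearMap.continuous_of_finiteDimensional _).measurable,
    Real.map_matrix_volume_pi_eq_smul_volume_pi hM, Measure.map_smul, h2.map_eq]

lemma qf_linT {M : Matrix (Fin d) (Fin d) ℝ} (hM : M.det ≠ 0) (v : Fin d → ℝ) :
    qf (M * M.transpose)⁻¹ (linT M v) = ∑ i, v i ^ 2 := by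
  have h1 : qf (M * M.transpose)⁻¹ (linT M v) =
      dotProduct (M.mulVec v) ((M * M.transpose)⁻¹.mulVec (M.mulVec v)) := by
    simp only [qf, linT, dotProduct, Matrix.mulVec, Finset.mul_sum, Matrix.toLin'_apply]
    simp only [Finset.sum_mul]
    simp [mul_assoc]
  have hu : IsUnit M.det := hM.isUnit
  rw [h1, Matrix.mulVec_mulVec, Matrix.mul_inv_rev, Matrix.mul_assoc, Matrix.nonsing_inv_mul _ hu,
    Matrix.mul_one, Matrix.dotProduct_mulVec, ← Matrix.mulVec_transpose, Matrix.mulVec_mulVec,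
    Matrix.transpose_nonsing_inv, Matrix.transpose_transpose, Matrix.nonsing_inv_mul _ hu,
    Matrix.one_mulVec]
  simp [dotProduct, sq]

lemma gdens_meas : Measurable fun x : EuclideanSpace ℝ (Fin d) =>
    (Real.sqrt (((2 * Real.pi) ^ d * K.det)⁻¹) * Real.exp (-(qf K⁻¹ x) / 2)) := by
  unfold qf
  fun_prop

lemma gauss_laplace (hK : K.PosDef) (z : Fin d → ℂ) :
    Integrable (fun y : EuclideanSpace ℝ (Fin d) => Complex.exp (∑ i, z i * (y i : ℂ)))
      (gaussianMeasure d K) ∧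
    ∫ y : EuclideanSpace ℝ (Fin d), Complex.exp (∑ i, z i * (y i : ℂ)) ∂(gaussianMeasure d K) =
      Complex.exp ((∑ i, ∑ j, z i * z j * (K i j : ℂ)) / 2) := by
  obtain ⟨M, hKM, hM⟩ := exists_sqrt_mat hK
  have hmap := linT_map hM
  have hemb := linT_emb hM
  set c := Real.sqrt (((2 * Real.pi) ^ d * K.det)⁻¹) with hc
  have hvol : (volume : Measure (EuclideanSpace ℝ (Fin d))) =
      ENNReal.ofReal |M.det| • Measure.map (linT M) volume := by
    rw [hmap, smul_smul, ← ENNReal.ofReal_mul (abs_nonneg _), ← abs_mul,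
      mul_inv_cancel₀ hM]
    simp
  -- the pulled back integrand
  set G : EuclideanSpace ℝ (Fin d) → ℂ := fun x =>
    (ENNReal.ofReal (c * Real.exp (-(qf K⁻¹ x) / 2))).toReal • Complex.exp (∑ i, z i * (x i : ℂ))
    with hG
  have hGT : ∀ v, G (linT M v) = (c : ℂ) * Complex.exp (-(1/2 : ℂ) * ∑ i, (v i : ℂ) ^ 2 +
      ∑ j, (∑ i, z i * M i j) * v j) := by
    intro v
    simp only [hG]
    rw [ENNReal.toReal_ofReal (by positivity), hKM, qf_linT hM, Complex.exp_add]
    rw [Complex.real_smul, Complex.ofReal_mul, Complex.ofReal_exp, mul_assoc]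
    have hx : ∑ i, z i * ((linT M v i : ℝ) : ℂ) = ∑ j, (∑ i, z i * (M i j : ℂ)) * (v j : ℂ) := by
      simp only [linT_apply, Finset.sum_mul]
      rw [Finset.sum_comm]
      refine Finset.sum_congr rfl fun i _ => ?_
      push_cast
      rw [Finset.mul_sum]
      exact Finset.sum_congr rfl fun j _ => by ring
    rw [hx]
    congr 3
    push_cast
    ring
  have hb : 0 < (1/2 : ℂ).re := by norm_num
  have hfin : ∀ᵐ x : EuclideanSpace ℝ (Fin d),
      ENNReal.ofReal (c * Real.exp (-(qf K⁻¹ x) / 2)) < ⊤ :=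
    ae_of_all _ fun x => ENNReal.ofReal_lt_top
  have hmeas := (gdens_meas (K := K)).ennreal_ofReal
  have hsum : ∑ i, (∑ k, z k * M k i) ^ 2 = ∑ i, ∑ j, z i * z j * (K i j : ℂ) := by
    rw [hKM]
    simp only [Matrix.mul_apply, Matrix.transpose_apply, Complex.ofReal_sum, Complex.ofReal_mul,
      sq, Finset.mul_sum]
    rw [Finset.sum_comm]
    refine Finset.sum_congr rfl fun i _ => ?_
    rw [Finset.sum_comm]
    refine Finset.sum_congr rfl fun j _ => ?_
    rw [Finset.sum_mul]
    refine Finset.sum_congr rfl fun k _ => ?_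
    ring
  refine ⟨?_, ?_⟩
  · unfold gaussianMeasure
    rw [integrable_withDensity_iff_integrable_smul₀' hmeas.aemeasurable hfin]
    change Integrable G volume
    rw [hvol]
    refine Integrable.smul_measure ?_ ENNReal.ofReal_ne_top
    rw [hemb.integrable_map_iff]
    refine ((GaussianFourier.integrable_cexp_neg_mul_sum_add hb
      (fun j => ∑ i, z i * M i j)).const_mul (c : ℂ)).congr (ae_of_all _ fun v => ?_)
    exact (hGT v).symm
  · unfold gaussianMeasure
    rw [integral_withDensity_eq_integral_toReal_smul hmeas hfin]
    change ∫ x, G x = _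
    rw [hvol, integral_smul_measure, hemb.integral_map]
    simp_rw [hGT]
    rw [integral_const_mul, GaussianFourier.integral_cexp_neg_mul_sum_add hb, hsum]
    rw [ENNReal.toReal_ofReal (abs_nonneg _), Complex.real_smul]
    have h4 : (4 * (1/2 : ℂ)) = 2 := by norm_num
    rw [h4, ← mul_assoc, ← mul_assoc]
    have hone : ((|M.det| : ℝ) : ℂ) * (c : ℂ) * ((Real.pi / (1/2 : ℂ)) ^ ((Fintype.card (Fin d) : ℂ) / 2)) = 1 := by
      have h2pi : (Real.pi / (1/2 : ℂ)) = ((2 * Real.pi : ℝ) : ℂ) := by push_cast; ring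
      have : ((Fintype.card (Fin d) : ℂ) / 2) = (((d : ℝ) * (1/2) : ℝ) : ℂ) := by
        push_cast; simp; ring
      rw [h2pi, this, ← Complex.ofReal_cpow (by positivity), ← Complex.ofReal_mul,
        ← Complex.ofReal_mul, Complex.ofReal_eq_one, Real.rpow_mul (by positivity),
        Real.rpow_natCast, ← Real.sqrt_eq_rpow, hc, hKM, Matrix.det_mul, Matrix.det_transpose,
        Real.sqrt_inv, Real.sqrt_mul (by positivity), Real.sqrt_mul_self_eq_abs]
      have h1 : Real.sqrt ((2 * Real.pi) ^ d) ≠ 0 := by positivity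
      have h2 : |M.det| ≠ 0 := abs_ne_zero.2 hM
      field_simp
    rw [hone, one_mul]

lemma gauss_prob (hK : K.PosDef) : IsProbabilityMeasure (gaussianMeasure d K) := by
  obtain ⟨h1, h2⟩ := gauss_laplace hK 0
  simp only [Pi.zero_apply, zero_mul, Finset.sum_const_zero, Complex.exp_zero, zero_div] at h1 h2
  rw [integrable_const_iff] at h1
  have : IsFiniteMeasure (gaussianMeasure d K) := by
    rcases h1 with h1 | h1
    · simp at h1
    · exact h1
  rw [integral_const] at h2
  constructor
  have h3 : (gaussianMeasure d K).real Set.univ = 1 := by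
    have : (((gaussianMeasure d K).real Set.univ : ℝ) : ℂ) = 1 := by simpa using h2
    exact_mod_cast this
  rw [measureReal_def] at h3
  rwa [← ENNReal.toReal_eq_one_iff]

end gauss

section shell
variable {d : ℕ}

/-- exponential tilting -/
def tilt (h : Fin d → ℝ) (μ : Measure (EuclideanSpace ℝ (Fin d))) :
    Measure (EuclideanSpace ℝ (Fin d)) :=
  μ.withDensity fun y => ENNReal.ofReal (Real.exp (∑ i, h i * y i))

lemma shell_one (f : EuclideanSpace ℝ (Fin d) → ℝ≥0∞) (hf : Measurable f) (Q : ℝ≥0∞)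
    (w : EuclideanSpace ℝ (Fin d)) (A : Set (EuclideanSpace ℝ (Fin d))) (hA : MeasurableSet A)
    (t : ℝ) (n : ℕ) (hn : (n : ℝ) * t ≤ 1) (ht : 0 < t)
    (h1 : ∀ x ∈ A, ∀ s : ℝ, 0 ≤ s → s ≤ 1 → f x ≤ Q * f (x + s • w))
    (hdis : ∀ x ∈ A, ∀ j : ℕ, 0 < j → x + ((j : ℝ) * t) • w ∉ A) :
    ((n + 1 : ℕ) : ℝ≥0∞) * volume.withDensity f A ≤ Q * volume.withDensity f Set.univ := by
  set Ak : ℕ → Set (EuclideanSpace ℝ (Fin d)) := fun k => {y | y - ((k : ℝ) * t) • w ∈ A} with hAk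
  have hAkm : ∀ k, MeasurableSet (Ak k) := fun k =>
    (measurable_id.sub_const (((k : ℝ) * t) • w)) hA
  have hd : Pairwise (Function.onFun Disjoint Ak) := by
    have key : ∀ k l : ℕ, k < l → Disjoint (Ak k) (Ak l) := by
      intro k l hkl
      rw [Set.disjoint_left]
      intro y hk hl
      have := hdis _ hl (l - k) (by omega)
      apply this
      have e : y - ((l : ℝ) * t) • w + (((l - k : ℕ) : ℝ) * t) • w = y - ((k : ℝ) * t) • w := by
        rw [Nat.cast_sub hkl.le]
        module
      rw [e]; exact hk
    intro k l hkl
    rcases lt_or_gt_of_ne hkl with h | h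
    · exact key k l h
    · exact (key l k h).symm
  have hk : ∀ k ∈ Finset.range (n + 1), volume.withDensity f A ≤ Q * volume.withDensity f (Ak k) := by
    intro k hk
    have hk' : k ≤ n := by simpa [Nat.lt_succ_iff] using hk
    have hk1 : (k : ℝ) * t ≤ 1 := by
      refine le_trans ?_ hn
      gcongr
    rw [withDensity_apply _ hA, withDensity_apply _ (hAkm k)]
    calc ∫⁻ x in A, f x ≤ ∫⁻ x in A, Q * f (x + ((k : ℝ) * t) • w) :=
          setLIntegral_mono' hA fun x hx => h1 x hx _ (by positivity) hk1
      _ = Q * ∫⁻ x in A, f (x + ((k : ℝ) * t) • w) := by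
          rw [lintegral_const_mul]; fun_prop
      _ = Q * ∫⁻ x in Ak k, f x := by
          congr 1
          have := (measurePreserving_add_right (volume : Measure (EuclideanSpace ℝ (Fin d)))
            (((k : ℝ) * t) • w)).setLIntegral_comp_preimage (hAkm k) hf
          rw [← this]
          congr 2
          ext x
          simp [hAk]
  calc ((n + 1 : ℕ) : ℝ≥0∞) * volume.withDensity f A
      = ∑ k ∈ Finset.range (n + 1), volume.withDensity f A := by simp
    _ ≤ ∑ k ∈ Finset.range (n + 1), Q * volume.withDensity f (Ak k) := Finset.sum_le_sum hk
    _ = Q * ∑ k ∈ Finset.range (n + 1), volume.withDensity f (Ak k) := by rw [Finset.mul_sum]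
    _ = Q * volume.withDensity f (⋃ k ∈ Finset.range (n + 1), Ak k) := by
        rw [measure_biUnion_finset (fun i _ j _ hij => hd hij) (fun k _ => hAkm k)]
    _ ≤ _ := by gcongr; exact Set.subset_univ _

lemma shell_abs (f : EuclideanSpace ℝ (Fin d) → ℝ≥0∞) (hf : Measurable f) (Q m : ℝ)
    (hm : volume.withDensity f Set.univ ≤ ENNReal.ofReal m) (hm0 : 0 ≤ m)
    (hQ : 1 ≤ Q) (P : Set (EuclideanSpace ℝ (Fin d))) (hP : MeasurableSet P)
    (v : EuclideanSpace ℝ (Fin d)) (F : Set (EuclideanSpace ℝ (Fin d))) (hF : MeasurableSet F)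
    (hFc : Convex ℝ F) (t : ℝ) (ht : 0 < t)
    (h1 : ∀ x ∈ P, ∀ s : ℝ, 0 ≤ s → s ≤ 1 → f x ≤ ENNReal.ofReal Q * f (x + s • v))
    (h2 : ∀ x ∉ P, ∀ s : ℝ, 0 ≤ s → s ≤ 1 → f x ≤ ENNReal.ofReal Q * f (x + s • (-v))) :
    volume.withDensity f {x ∈ F | x + t • v ∉ F} ≤ ENNReal.ofReal (2 * Q * m * t) := by
  rcases lt_or_ge 1 t with h | h
  · refine (measure_mono (Set.subset_univ _)).trans (hm.trans ?_)
    apply ENNReal.ofReal_le_ofReal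
    nlinarith [mul_le_mul_of_nonneg_right hQ hm0, mul_nonneg (by linarith : 0 ≤ Q) hm0]
  set A := {x ∈ F | x + t • v ∉ F} with hA
  have hAm : MeasurableSet A := hF.inter ((measurable_id.add_const (t • v)) hF.compl)
  have hdis : ∀ x ∈ A, ∀ j : ℕ, 0 < j → x + ((j : ℝ) * t) • v ∉ A := by
    intro x hx j hj hx2
    apply hx.2
    have hj1 : (1 : ℝ) ≤ j := by exact_mod_cast hj
    have := hFc hx.1 hx2.1 (a := 1 - 1 / (j : ℝ)) (b := 1 / (j : ℝ))
      (by rw [sub_nonneg, div_le_one (by positivity)]; exact hj1) (by positivity) (by ring)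
    convert this using 1
    have : (j : ℝ) ≠ 0 := by positivity
    rw [smul_add, smul_smul, ← add_assoc, ← add_smul]
    congr 1
    · simp
    · congr 1; field_simp
  set n := ⌊1 / t⌋₊ with hn
  have hnt : (n : ℝ) * t ≤ 1 := by
    have := Nat.floor_le (show 0 ≤ 1 / t by positivity)
    calc (n : ℝ) * t ≤ 1 / t * t := by gcongr
      _ = 1 := by field_simp
  have hnt2 : 1 ≤ ((n + 1 : ℕ) : ℝ) * t := by
    have := Nat.lt_floor_add_one (1 / t)
    calc 1 = 1 / t * t := by field_simp
      _ ≤ _ := by push_cast; gcongr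
  have fin : ∀ X : Set (EuclideanSpace ℝ (Fin d)),
      ((n + 1 : ℕ) : ℝ≥0∞) * volume.withDensity f X ≤
        ENNReal.ofReal Q * volume.withDensity f Set.univ →
      volume.withDensity f X ≤ ENNReal.ofReal (Q * m * t) := by
    intro X hX
    calc volume.withDensity f X = ENNReal.ofReal 1 * volume.withDensity f X := by simp
      _ ≤ ENNReal.ofReal (((n + 1 : ℕ) : ℝ) * t) * volume.withDensity f X := by gcongr
      _ = ENNReal.ofReal t * (((n + 1 : ℕ) : ℝ≥0∞) * volume.withDensity f X) := by
          rw [ENNReal.ofReal_mul (by positivity), ENNReal.ofReal_natCast]; ring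
      _ ≤ ENNReal.ofReal t * (ENNReal.ofReal Q * ENNReal.ofReal m) := by
          refine mul_le_mul' le_rfl (hX.trans ?_)
          gcongr
      _ = _ := by
          rw [← ENNReal.ofReal_mul (by linarith), ← ENNReal.ofReal_mul ht.le]
          congr 1; ring
  have e1 := fin (A ∩ P) (shell_one f hf _ v (A ∩ P) (hAm.inter hP) t n hnt ht
    (fun x hx => h1 x hx.2) (fun x hx j hj hx2 => hdis x hx.1 j hj hx2.1))
  have e2 := fin (A ∩ Pᶜ) (shell_one f hf _ (-v) (A ∩ Pᶜ) (hAm.inter hP.compl) t n hnt ht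
    (fun x hx => h2 x hx.2) (fun x hx j hj hx2 => hdis _ hx2.1 j hj (by
      have : x + ((j : ℝ) * t) • -v + ((j : ℝ) * t) • v = x := by module
      rw [this]; exact hx.1)))
  calc volume.withDensity f A ≤ volume.withDensity f (A ∩ P) + volume.withDensity f (A ∩ Pᶜ) := by
        rw [← Set.sdiff_eq, measure_inter_add_sdiff _ hP]
    _ ≤ _ := add_le_add e1 e2
    _ = _ := by
      rw [← ENNReal.ofReal_add (by positivity) (by positivity)]
      congr 1; ring

/-- basis direction with sign -/
def sdir (p : Fin d × Bool) : EuclideanSpace ℝ (Fin d) :=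
  (if p.2 then (1 : ℝ) else -1) • EuclideanSpace.single p.1 (1 : ℝ)

lemma exists_sdir (hd : 0 < d) (f : EuclideanSpace ℝ (Fin d) →L[ℝ] ℝ) :
    ∃ p : Fin d × Bool, ‖f‖ ≤ d * f (sdir p) := by
  have : Nonempty (Fin d) := ⟨⟨0, hd⟩⟩
  obtain ⟨i, hi⟩ := Finite.exists_max (fun i : Fin d => |f (EuclideanSpace.single i 1)|)
  have hnorm : ‖f‖ ≤ d * |f (EuclideanSpace.single i 1)| := by
    refine f.opNorm_le_bound (by positivity) fun x => ?_
    have hx : x = ∑ j, x j • EuclideanSpace.single j (1 : ℝ) := by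
      ext k
      simp [Finset.sum_apply, Pi.single_apply]
    conv_lhs => rw [hx]
    rw [map_sum]
    refine (norm_sum_le _ _).trans ?_
    calc ∑ j, ‖f (x j • EuclideanSpace.single j (1 : ℝ))‖
        ≤ ∑ j : Fin d, |f (EuclideanSpace.single i 1)| * ‖x‖ := by
          refine Finset.sum_le_sum fun j _ => ?_
          rw [map_smul, smul_eq_mul, norm_mul, mul_comm]
          gcongr
          · exact hi j
          · exact PiLp.norm_apply_le x j
      _ = _ := by simp; ring
  rcases le_total 0 (f (EuclideanSpace.single i 1)) with h | h
  · refine ⟨(i, true), ?_⟩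
    rw [abs_of_nonneg h] at hnorm
    simpa [sdir] using hnorm
  · refine ⟨(i, false), ?_⟩
    rw [abs_of_nonpos h] at hnorm
    simpa [sdir] using hnorm

lemma geom_out (hd : 0 < d) {C : Set (EuclideanSpace ℝ (Fin d))} (hC : Convex ℝ C) {s : ℝ}
    (hs : 0 < s) : Metric.thickening s C \ closure C ⊆
    ⋃ p : Fin d × Bool, {x ∈ Metric.thickening s C | x + (s * d) • sdir p ∉ Metric.thickening s C} := by
  rintro x ⟨hx, hxc⟩
  obtain ⟨f, u, hfa, hfx⟩ := geometric_hahn_banach_closed_point hC.closure isClosed_closure hxc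
  obtain ⟨p, hp⟩ := exists_sdir hd f
  refine Set.mem_iUnion.2 ⟨p, hx, fun hy => ?_⟩
  obtain ⟨c, hc, hyc⟩ := Metric.mem_thickening_iff.1 hy
  have h1 := hfa c (subset_closure hc)
  have h2 : f (x + (s * d) • sdir p) = f c + f (x + (s * d) • sdir p - c) := by
    rw [← map_add]; simp
  have h3 : f (x + (s * d) • sdir p - c) ≤ ‖f‖ * s := by
    refine (le_abs_self _).trans ((f.le_opNorm _).trans ?_)
    rw [dist_eq_norm] at hyc
    gcongr
  rw [map_add, map_smul, smul_eq_mul] at h2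
  nlinarith

lemma geom_in (hd : 0 < d) {C : Set (EuclideanSpace ℝ (Fin d))} (hC : Convex ℝ C) {s : ℝ}
    (hs : 0 < s) : interior C ∩ Metric.thickening s Cᶜ ⊆
    ⋃ p : Fin d × Bool, {x ∈ interior C | x + (s * d) • sdir p ∉ interior C} := by
  rintro x ⟨hx, hxc⟩
  obtain ⟨z, hz, hxz⟩ := Metric.mem_thickening_iff.1 hxc
  have hz' : z ∉ interior C := fun h => hz (interior_subset h)
  obtain ⟨f, hfa⟩ := geometric_hahn_banach_open_point hC.interior isOpen_interior hz'
  obtain ⟨p, hp⟩ := exists_sdir hd f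
  refine Set.mem_iUnion.2 ⟨p, hx, fun hy => ?_⟩
  have h1 := hfa _ hy
  have h3 : f (z - x) ≤ ‖f‖ * s := by
    refine (le_abs_self _).trans ((f.le_opNorm _).trans ?_)
    rw [dist_comm, dist_eq_norm] at hxz
    gcongr
  rw [map_add, map_smul, smul_eq_mul] at h1
  rw [map_sub] at h3
  nlinarith

end shell

section gshell
variable {d : ℕ} {K : Matrix (Fin d) (Fin d) ℝ}

/-- tilted Gaussian density -/
def gd (K : Matrix (Fin d) (Fin d) ℝ) (h : Fin d → ℝ) (x : EuclideanSpace ℝ (Fin d)) : ℝ≥0∞ :=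
  ENNReal.ofReal (Real.sqrt (((2 * Real.pi) ^ d * K.det)⁻¹) *
    Real.exp (-(qf K⁻¹ x) / 2 + ∑ i, h i * x i))

lemma gd_meas (h : Fin d → ℝ) : Measurable (gd K h) := by
  unfold gd qf
  fun_prop

lemma tilt_gauss (h : Fin d → ℝ) : tilt h (gaussianMeasure d K) = volume.withDensity (gd K h) := by
  unfold tilt gaussianMeasure
  rw [← withDensity_mul _ (gdens_meas.ennreal_ofReal) (by fun_prop)]
  congr 1
  ext x
  simp only [Pi.mul_apply, gd]
  rw [← ENNReal.ofReal_mul (by positivity), Real.exp_add, mul_assoc]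

lemma tilt_gauss_ac (h : Fin d → ℝ) : tilt h (gaussianMeasure d K) ≪ volume := by
  rw [tilt_gauss]; exact withDensity_absolutelyContinuous _ _

lemma qf_add (L : Matrix (Fin d) (Fin d) ℝ) (x v : EuclideanSpace ℝ (Fin d)) (s : ℝ) :
    qf L (x + s • v) = qf L x + s * (∑ i, ∑ j, (x i * L i j * v j + v i * L i j * x j)) +
      s ^ 2 * qf L v := by
  simp only [qf, Finset.mul_sum, ← Finset.sum_add_distrib]
  refine Finset.sum_congr rfl fun i _ => Finset.sum_congr rfl fun j _ => ?_
  simp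
  ring

lemma gd_step (h : Fin d → ℝ) (q : ℝ) (x w : EuclideanSpace ℝ (Fin d)) (hw : |qf K⁻¹ w| ≤ q)
    (hx : 0 ≤ -(∑ i, ∑ j, (x i * K⁻¹ i j * w j + w i * K⁻¹ i j * x j)) / 2 + ∑ i, h i * w i)
    (s : ℝ) (hs : 0 ≤ s) (hs1 : s ≤ 1) :
    gd K h x ≤ ENNReal.ofReal (Real.exp q) * gd K h (x + s • w) := by
  unfold gd
  rw [← ENNReal.ofReal_mul (by positivity)]
  apply ENNReal.ofReal_le_ofReal
  rw [mul_left_comm, ← Real.exp_add]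
  refine mul_le_mul_of_nonneg_left ?_ (by positivity)
  apply Real.exp_le_exp.2
  rw [qf_add]
  have e : ∑ i, h i * (x + s • w) i = ∑ i, h i * x i + s * ∑ i, h i * w i := by
    rw [Finset.mul_sum, ← Finset.sum_add_distrib]
    refine Finset.sum_congr rfl fun i _ => ?_
    simp; ring
  rw [e]
  have h1 : s ^ 2 * qf K⁻¹ w ≤ q := by
    have h0 : 0 ≤ q := (abs_nonneg _).trans hw
    have : s ^ 2 ≤ 1 := by nlinarith
    calc s ^ 2 * qf K⁻¹ w ≤ s ^ 2 * q := by gcongr; exact (le_abs_self _).trans hw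
      _ ≤ 1 * q := by gcongr
      _ = q := one_mul q
  have h0 : 0 ≤ q := (abs_nonneg _).trans hw
  nlinarith [mul_nonneg hs hx]

lemma qf_neg (L : Matrix (Fin d) (Fin d) ℝ) (v : EuclideanSpace ℝ (Fin d)) :
    qf L (-v) = qf L v := by
  simp [qf]

lemma exists_q (L : Matrix (Fin d) (Fin d) ℝ) : ∃ q : ℝ, 0 ≤ q ∧ ∀ p : Fin d × Bool, |qf L (sdir p)| ≤ q := by
  refine ⟨∑ p : Fin d × Bool, |qf L (sdir p)|, Finset.sum_nonneg fun _ _ => abs_nonneg _, fun p => ?_⟩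
  exact Finset.single_le_sum (f := fun p => |qf L (sdir p)|) (fun _ _ => abs_nonneg _) (Finset.mem_univ p)

lemma gauss_shell_dir (h : Fin d → ℝ) [IsFiniteMeasure (tilt h (gaussianMeasure d K))] :
    ∃ Q : ℝ, 0 ≤ Q ∧ ∀ (F : Set (EuclideanSpace ℝ (Fin d))), MeasurableSet F → Convex ℝ F →
      ∀ t : ℝ, 0 < t → ∀ p : Fin d × Bool,
      (tilt h (gaussianMeasure d K)) {x ∈ F | x + t • sdir p ∉ F} ≤ ENNReal.ofReal (Q * t) := by
  obtain ⟨q, hq0, hq⟩ := exists_q (K⁻¹)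
  set m := ((tilt h (gaussianMeasure d K)) Set.univ).toReal with hm
  have hm' : (tilt h (gaussianMeasure d K)) Set.univ ≤ ENNReal.ofReal m := by
    rw [hm, ENNReal.ofReal_toReal (measure_ne_top _ _)]
  refine ⟨2 * Real.exp q * m, by positivity, fun F hF hFc t ht p => ?_⟩
  rw [tilt_gauss] at hm' ⊢
  set v := sdir p
  refine shell_abs (gd K h) (gd_meas h) (Real.exp q) m hm' ENNReal.toReal_nonneg
    (Real.one_le_exp hq0)
    {x | 0 ≤ -(∑ i, ∑ j, (x i * K⁻¹ i j * v j + v i * K⁻¹ i j * x j)) / 2 + ∑ i, h i * v i} ?_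
    v F hF hFc t ht ?_ ?_
  · apply measurableSet_le <;> fun_prop
  · intro x hx s hs hs1
    exact gd_step h q x v (hq p) hx s hs hs1
  · intro x hx s hs hs1
    refine gd_step h q x (-v) (by rw [qf_neg]; exact hq p) ?_ s hs hs1
    simp only [Set.mem_setOf_eq, not_le] at hx
    have e1 : ∑ i, ∑ j, (x i * K⁻¹ i j * (-v) j + (-v) i * K⁻¹ i j * x j) =
      -∑ i, ∑ j, (x i * K⁻¹ i j * v j + v i * K⁻¹ i j * x j) := by
      simp only [← Finset.sum_neg_distrib]
      refine Finset.sum_congr rfl fun i _ => Finset.sum_congr rfl fun j _ => ?_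
      simp; ring
    have e2 : ∑ i, h i * (-v) i = -∑ i, h i * v i := by
      simp
    rw [e1, e2]
    linarith

lemma gauss_shell (hd : 0 < d) (h : Fin d → ℝ) [IsFiniteMeasure (tilt h (gaussianMeasure d K))] :
    ∃ Q : ℝ, 0 ≤ Q ∧ ∀ (C : Set (EuclideanSpace ℝ (Fin d))), Convex ℝ C → 
      ∀ s : ℝ, 0 < s → 
      (tilt h (gaussianMeasure d K)).real (Metric.thickening s C) ≤
        (tilt h (gaussianMeasure d K)).real C + Q * s ∧
      (tilt h (gaussianMeasure d K)).real C ≤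
        (tilt h (gaussianMeasure d K)).real (Metric.thickening s Cᶜ)ᶜ + Q * s := by
  obtain ⟨Q, hQ0, hQ⟩ := gauss_shell_dir (K := K) h
  refine ⟨∑ p : Fin d × Bool, Q * d, by positivity, fun C hC s hs => ?_⟩
  set γ := tilt h (gaussianMeasure d K) with hγ
  have hbound : ∀ F : Set (EuclideanSpace ℝ (Fin d)), MeasurableSet F → Convex ℝ F →
      γ.real (⋃ p : Fin d × Bool, {x ∈ F | x + (s * d) • sdir p ∉ F}) ≤
        (∑ p : Fin d × Bool, Q * d) * s := by
    intro F hF hFc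
    refine (measureReal_iUnion_fintype_le _).trans ?_
    rw [Finset.sum_mul]
    refine Finset.sum_le_sum fun p _ => ?_
    have := hQ F hF hFc (s * d) (by positivity) p
    rw [measureReal_def]
    refine ENNReal.toReal_le_of_le_ofReal (by positivity) (this.trans (le_of_eq ?_))
    congr 1; ring
  have hfr : γ.real (frontier C) = 0 := by
    rw [measureReal_def, tilt_gauss_ac h (hC.addHaar_frontier volume)]; simp
  constructor
  · have h1 : Metric.thickening s C ⊆ (C ∪ frontier C) ∪ (Metric.thickening s C \ closure C) := by
      intro x hx
      by_cases hxc : x ∈ closure C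
      · left; rw [← closure_eq_self_union_frontier]; exact hxc
      · right; exact ⟨hx, hxc⟩
    have h2 := hbound _ Metric.isOpen_thickening.measurableSet (hC.thickening s)
    have h3 := measureReal_mono (μ := γ) (geom_out hd hC hs)
    calc γ.real (Metric.thickening s C) ≤ _ := measureReal_mono h1
      _ ≤ γ.real (C ∪ frontier C) + γ.real (Metric.thickening s C \ closure C) :=
        measureReal_union_le _ _
      _ ≤ (γ.real C + γ.real (frontier C)) + _ := add_le_add (measureReal_union_le _ _) (h3.trans h2)
      _ = _ := by rw [hfr, add_zero]
  · have h1 : C ⊆ ((Metric.thickening s Cᶜ)ᶜ ∪ frontier C) ∪ (interior C ∩ Metric.thickening s Cᶜ) := by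
      intro x hx
      by_cases hxc : x ∈ interior C
      · by_cases hxt : x ∈ Metric.thickening s Cᶜ
        · right; exact ⟨hxc, hxt⟩
        · left; left; exact hxt
      · left; right; exact ⟨subset_closure hx, hxc⟩
    have h2 := hbound _ isOpen_interior.measurableSet hC.interior
    have h3 := measureReal_mono (μ := γ) (geom_in hd hC hs)
    calc γ.real C ≤ _ := measureReal_mono h1
      _ ≤ γ.real ((Metric.thickening s Cᶜ)ᶜ ∪ frontier C) + γ.real (interior C ∩ Metric.thickening s Cᶜ) :=
        measureReal_union_le _ _
      _ ≤ (γ.real (Metric.thickening s Cᶜ)ᶜ + γ.real (frontier C)) + _ := add_le_add (measureReal_union_le _ _) (h3.trans h2)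
      _ = _ := by rw [hfr, add_zero]

end gshell

section smoothing
variable {d : ℕ}

lemma erosion_convex {C : Set (EuclideanSpace ℝ (Fin d))} (hC : Convex ℝ C) (s : ℝ) :
    Convex ℝ (Metric.thickening s Cᶜ)ᶜ := by
  intro x hx y hy a b ha hb hab hw
  obtain ⟨z, hz, hwz⟩ := Metric.mem_thickening_iff.1 hw
  set w := a • x + b • y with hwdef
  have hin : ∀ u ∈ (Metric.thickening s Cᶜ)ᶜ, u + (z - w) ∈ C := by
    intro u hu
    by_contra hc
    apply hu
    refine Metric.mem_thickening_iff.2 ⟨_, hc, ?_⟩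
    rw [dist_eq_norm] at hwz ⊢
    rwa [sub_add_cancel_left, neg_sub]
  apply hz
  have := hC (hin x hx) (hin y hy) ha hb hab
  convert this using 1
  have : a • (x + (z - w)) + b • (y + (z - w)) = w + (a + b) • (z - w) := by
    rw [hwdef]; module
  rw [this, hab]; simp

lemma core_avg {κ : Measure (EuclideanSpace ℝ (Fin d))} [IsProbabilityMeasure κ]
    {g : EuclideanSpace ℝ (Fin d) → ℝ} (hg : Integrable g κ) {R Δ b c η : ℝ} (hη : η ≤ 1 / 2)
    (hb : 0 ≤ b) (hc : 0 ≤ c) (hη0 : 0 ≤ η)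
    (hR : κ.real {z | R ≤ ‖z‖} ≤ η) (h1 : ∀ z, ‖z‖ < R → Δ ≤ g z) (h2 : ∀ z, R ≤ ‖z‖ → -b ≤ g z)
    (hI : ∫ z, g z ∂κ ≤ c) : Δ ≤ 2 * c + 2 * (η * b) := by
  rcases le_total Δ 0 with h0 | h0
  · have := mul_nonneg hη0 hb; linarith
  have hm : MeasurableSet {z : EuclideanSpace ℝ (Fin d) | R ≤ ‖z‖} :=
    measurableSet_le measurable_const measurable_norm
  have hle : ∫ z, (Δ + {z : EuclideanSpace ℝ (Fin d) | R ≤ ‖z‖}.indicator (fun _ => -b - Δ) z) ∂κ ≤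
      ∫ z, g z ∂κ := by
    refine integral_mono ((integrable_const _).add ((integrable_const _).indicator hm)) hg ?_
    intro z
    by_cases hz : R ≤ ‖z‖
    · simp [Set.indicator, hz]; linarith [h2 z hz]
    · simp [Set.indicator, hz]; exact h1 z (not_le.1 hz)
  rw [integral_add (integrable_const _) ((integrable_const _).indicator hm),
    integral_indicator hm, setIntegral_const, integral_const] at hle
  simp only [probReal_univ, smul_eq_mul, one_mul] at hle
  nlinarith [mul_le_mul_of_nonneg_right hR (by linarith : 0 ≤ b + Δ),
    mul_le_mul_of_nonneg_right hη h0]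

lemma translate_meas (ε : ℝ) {F : Set (EuclideanSpace ℝ (Fin d))} (hF : MeasurableSet F)
    (μ : Measure (EuclideanSpace ℝ (Fin d))) [IsFiniteMeasure μ]
    (κ : Measure (EuclideanSpace ℝ (Fin d))) [IsFiniteMeasure κ] :
    Integrable (fun z => μ.real {y | y + ε • z ∈ F}) κ := by
  have hs : MeasurableSet {p : EuclideanSpace ℝ (Fin d) × EuclideanSpace ℝ (Fin d) |
      p.2 + ε • p.1 ∈ F} := by
    have : Measurable fun p : EuclideanSpace ℝ (Fin d) × EuclideanSpace ℝ (Fin d) =>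
      p.2 + ε • p.1 := by fun_prop
    exact this hF
  have hm : Measurable fun z => μ.real {y | y + ε • z ∈ F} :=
    (measurable_measure_prodMk_left (ν := μ) hs).ennreal_toReal
  refine Integrable.of_bound hm.aestronglyMeasurable (μ.real Set.univ) (ae_of_all _ fun z => ?_)
  rw [Real.norm_eq_abs, abs_of_nonneg measureReal_nonneg]
  exact measureReal_mono (Set.subset_univ _)

lemma vol_le_diam {X : Set (EuclideanSpace ℝ (Fin d))} (hX : Bornology.IsBounded X) {δ : ℝ}
    (hδ : Metric.diam X ≤ δ) :
    volume.real X ≤ δ ^ d * volume.real (Metric.ball (0 : EuclideanSpace ℝ (Fin d)) 1) := by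
  have hδ0 : 0 ≤ δ := Metric.diam_nonneg.trans hδ
  rcases X.eq_empty_or_nonempty with rfl | ⟨x, hx⟩
  · simp; positivity
  have hsub : X ⊆ Metric.closedBall x δ := fun y hy =>
    (Metric.dist_le_diam_of_mem hX hy hx).trans hδ
  refine (measureReal_mono hsub measure_closedBall_lt_top.ne).trans (le_of_eq ?_)
  rw [measureReal_def, Measure.addHaar_closedBall _ _ hδ0, ENNReal.toReal_mul,
    ENNReal.toReal_ofReal (by positivity), measureReal_def]
  simp

section sets
variable {C : Set (EuclideanSpace ℝ (Fin d))} {r : ℝ} {w : EuclideanSpace ℝ (Fin d)}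

lemma tr_s1 (hw : ‖w‖ < r) : C ⊆ {y | y + w ∈ Metric.thickening r C} := by
  intro y hy
  rw [Set.mem_ofPred_eq, Metric.mem_thickening_iff]
  exact ⟨y, hy, by rw [dist_eq_norm, add_sub_cancel_left]; exact hw⟩

lemma tr_s2 (hw : ‖w‖ < r) : {y | y + w ∈ Metric.thickening r C} ⊆ Metric.thickening (2 * r) C := by
  intro y hy
  rw [Set.mem_ofPred_eq, Metric.mem_thickening_iff] at hy
  obtain ⟨c, hc, hyc⟩ := hy
  rw [Metric.mem_thickening_iff]
  refine ⟨c, hc, ?_⟩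
  have := dist_triangle y (y + w) c
  rw [dist_self_add_right] at this
  linarith

lemma tr_s3 (hw : ‖w‖ < r) : {y | y + w ∈ (Metric.thickening r Cᶜ)ᶜ} ⊆ C := by
  intro y hy
  rw [Set.mem_ofPred_eq] at hy
  by_contra hc
  exact hy (tr_s1 hw (Set.mem_compl hc))

lemma tr_s4 (hw : ‖w‖ < r) :
    (Metric.thickening (2 * r) Cᶜ)ᶜ ⊆ {y | y + w ∈ (Metric.thickening r Cᶜ)ᶜ} := by
  intro y hy
  rw [Set.mem_ofPred_eq]
  intro hy2
  exact hy (tr_s2 hw hy2)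

end sets

set_option maxHeartbeats 800000 in
lemma smoothing (μ γ κ : Measure (EuclideanSpace ℝ (Fin d))) [IsFiniteMeasure μ]
    [IsFiniteMeasure γ] [IsProbabilityMeasure κ] (Q M R ε : ℝ) (hQ : 0 ≤ Q) (hM : 0 ≤ M)
    (hR : 0 < R) (hε : 0 < ε) (hRε : R * ε ≤ 1)
    (hshell : ∀ (C : Set (EuclideanSpace ℝ (Fin d))), Convex ℝ C → ∀ s : ℝ, 0 < s →
      γ.real (Metric.thickening s C) ≤ γ.real C + Q * s ∧
      γ.real C ≤ γ.real (Metric.thickening s Cᶜ)ᶜ + Q * s)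
    (hκ : κ.real {z | R ≤ ‖z‖} ≤ 1 / (4 * 3 ^ d))
    (hI : ∀ F : Set (EuclideanSpace ℝ (Fin d)), MeasurableSet F → Bornology.IsBounded F →
      |∫ z, (μ.real {y | y + ε • z ∈ F} - γ.real {y | y + ε • z ∈ F}) ∂κ| ≤ volume.real F * M * ε)
    (C : Set (EuclideanSpace ℝ (Fin d))) (hC : Convex ℝ C) (hCm : MeasurableSet C)
    (hCb : Bornology.IsBounded C) :
    |μ.real C - γ.real C| ≤ 2 * (2 * Q * R + 2 * 3 ^ d *
      volume.real (Metric.ball (0 : EuclideanSpace ℝ (Fin d)) 1) * M) * ε *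
        (1 + Metric.diam C) ^ d := by
  set vb := volume.real (Metric.ball (0 : EuclideanSpace ℝ (Fin d)) 1) with hvb
  have hvb0 : 0 ≤ vb := measureReal_nonneg
  let T := {C : Set (EuclideanSpace ℝ (Fin d)) // Convex ℝ C ∧ MeasurableSet C ∧ Bornology.IsBounded C}
  let W : Set (EuclideanSpace ℝ (Fin d)) → ℝ := fun C => (1 + Metric.diam C) ^ d
  have hW1 : ∀ C, 1 ≤ W C := fun C => one_le_pow₀ (by linarith [Metric.diam_nonneg (s := C)])
  let q : T → ℝ := fun C => |μ.real C.1 - γ.real C.1| / W C.1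
  have hbdd : BddAbove (Set.range q) := by
    refine ⟨μ.real Set.univ + γ.real Set.univ, ?_⟩
    rintro _ ⟨C, rfl⟩
    refine (div_le_self (abs_nonneg _) (hW1 _)).trans ?_
    refine (abs_sub _ _).trans ?_
    rw [abs_of_nonneg measureReal_nonneg, abs_of_nonneg measureReal_nonneg]
    exact add_le_add (measureReal_mono (Set.subset_univ _)) (measureReal_mono (Set.subset_univ _))
  have : Nonempty T := ⟨⟨C, hC, hCm, hCb⟩⟩
  set a := ⨆ C, q C with ha
  have hP : ∀ C : Set (EuclideanSpace ℝ (Fin d)), Convex ℝ C → MeasurableSet C →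
      Bornology.IsBounded C → |μ.real C - γ.real C| ≤ a * W C := by
    intro C h1 h2 h3
    have := le_ciSup hbdd (⟨C, h1, h2, h3⟩ : T)
    rwa [← ha, div_le_iff₀ (by linarith [hW1 C])] at this
  have ha0 : 0 ≤ a := by
    have := (abs_nonneg _).trans (hP C hC hCm hCb)
    by_contra hneg
    nlinarith [hW1 C]
  set r := R * ε with hr
  have hr0 : 0 < r := by positivity
  -- translates
  have htr : ∀ F : Set (EuclideanSpace ℝ (Fin d)), Convex ℝ F → MeasurableSet F →
      Bornology.IsBounded F → ∀ z, |μ.real {y | y + ε • z ∈ F} - γ.real {y | y + ε • z ∈ F}| ≤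
        a * W F := by
    intro F h1 h2 h3 z
    have hdist : ∀ x ∈ {y | y + ε • z ∈ F}, ∀ y ∈ {y | y + ε • z ∈ F}, dist x y ≤ Metric.diam F := by
      intro x hx y hy
      have := Metric.dist_le_diam_of_mem h3 hx hy
      rwa [dist_add_right] at this
    refine (hP {y | y + ε • z ∈ F} ?_ ?_ ?_).trans ?_
    · exact h1.translate_preimage_left (ε • z)
    · exact (measurable_id.add_const (ε • z)) h2
    · exact Metric.isBounded_iff.2 ⟨_, fun x hx y hy => hdist x hx y hy⟩
    · refine mul_le_mul_of_nonneg_left ?_ ha0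
      have := Metric.diam_le_of_forall_dist_le Metric.diam_nonneg hdist
      have h0 := Metric.diam_nonneg (s := {y | y + ε • z ∈ F})
      exact pow_le_pow_left₀ (by linarith) (by linarith) _
  have h3d : (1 : ℝ) ≤ 3 ^ d := one_le_pow₀ (by norm_num)
  have hη : 1 / (4 * 3 ^ d : ℝ) ≤ 1 / 2 := by
    apply one_div_le_one_div_of_le <;> linarith
  have hW3 : ∀ F C : Set (EuclideanSpace ℝ (Fin d)), Metric.diam F ≤ Metric.diam C + 2 →
      W F ≤ 3 ^ d * W C := by
    intro F C h
    simp only [W]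
    rw [← mul_pow]
    have h0 := Metric.diam_nonneg (s := F)
    have h1 := Metric.diam_nonneg (s := C)
    exact pow_le_pow_left₀ (by linarith) (by linarith) _
  have hV3 : ∀ F C : Set (EuclideanSpace ℝ (Fin d)), Bornology.IsBounded F →
      Metric.diam F ≤ Metric.diam C + 2 → volume.real F ≤ 3 ^ d * W C * vb := by
    intro F C hF h
    have h1 := Metric.diam_nonneg (s := C)
    refine (vol_le_diam hF (δ := 3 * (1 + Metric.diam C)) (by linarith)).trans (le_of_eq ?_)
    rw [mul_pow]
  have hstep : ∀ C : Set (EuclideanSpace ℝ (Fin d)), Convex ℝ C → MeasurableSet C →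
      Bornology.IsBounded C → |μ.real C - γ.real C| ≤
        (a / 2 + (2 * Q * R + 2 * 3 ^ d * vb * M) * ε) * W C := by
    intro C hC hCm hCb
    have hWC := hW1 C
    have hend : ∀ Δ : ℝ, Δ - Q * (2 * r) ≤ 2 * (3 ^ d * W C * vb * M * ε) +
        2 * (1 / (4 * 3 ^ d) * (a * (3 ^ d * W C))) →
        Δ ≤ (a / 2 + (2 * Q * R + 2 * 3 ^ d * vb * M) * ε) * W C := by
      intro Δ h
      have e1 : 2 * (1 / (4 * 3 ^ d) * (a * (3 ^ d * W C))) = a / 2 * W C := by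
        field_simp; norm_num
      have e2 : Q * (2 * r) ≤ 2 * Q * R * ε * W C := by
        rw [hr]
        have : 0 ≤ 2 * Q * R * ε := by positivity
        nlinarith
      rw [e1] at h
      nlinarith
    have hb0 : 0 ≤ a * (3 ^ d * W C) := by positivity
    have hc0 : 0 ≤ 3 ^ d * W C * vb * M * ε := by positivity
    rw [abs_le']
    constructor
    · -- upper side
      apply hend
      set F := Metric.thickening r C with hF
      have hFb : Bornology.IsBounded F := hCb.thickening
      have hFm : MeasurableSet F := Metric.isOpen_thickening.measurableSet
      have hFc : Convex ℝ F := hC.thickening r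
      have hFd : Metric.diam F ≤ Metric.diam C + 2 := by
        have := Metric.diam_thickening_le (s := C) hr0.le
        linarith
      refine core_avg (R := R) ((translate_meas ε hFm μ κ).sub (translate_meas ε hFm γ κ)) hη
        hb0 hc0 (by positivity) hκ ?_ ?_ ?_
      · intro z hz
        have hzr : ‖ε • z‖ < r := by
          rw [norm_smul, Real.norm_eq_abs, abs_of_pos hε, hr, mul_comm]; gcongr
        have s1 : C ⊆ {y | y + ε • z ∈ F} := tr_s1 hzr
        have s2 : {y | y + ε • z ∈ F} ⊆ Metric.thickening (2 * r) C := tr_s2 hzr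
        have t1 := measureReal_mono (μ := μ) s1
        have t2 := measureReal_mono (μ := γ) s2
        have t3 := (hshell C hC (2 * r) (by positivity)).1
        simp only [Pi.sub_apply]
        linarith
      · intro z _
        have := (abs_le.1 (htr F hFc hFm hFb z)).1
        have h2 := mul_le_mul_of_nonneg_left (hW3 F C hFd) ha0
        simp only [Pi.sub_apply]
        linarith
      · refine (le_abs_self _).trans ((hI F hFm hFb).trans ?_)
        gcongr
        exact hV3 F C hFb hFd
    · apply hend
      set F := (Metric.thickening r Cᶜ)ᶜ with hF
      have hFC : F ⊆ C := by
        intro x hx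
        by_contra hc
        exact hx (Metric.self_subset_thickening hr0 _ hc)
      have hFb : Bornology.IsBounded F := hCb.subset hFC
      have hFm : MeasurableSet F := Metric.isOpen_thickening.measurableSet.compl
      have hFc : Convex ℝ F := erosion_convex hC r
      have hFd : Metric.diam F ≤ Metric.diam C + 2 := by
        have := Metric.diam_mono hFC hCb
        linarith
      refine core_avg (R := R) ((translate_meas ε hFm γ κ).sub (translate_meas ε hFm μ κ)) hη
        hb0 hc0 (by positivity) hκ ?_ ?_ ?_
      · intro z hz
        have hzr : ‖ε • z‖ < r := by
          rw [norm_smul, Real.norm_eq_abs, abs_of_pos hε, hr, mul_comm]; gcongr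
        have s1 : {y | y + ε • z ∈ F} ⊆ C := tr_s3 hzr
        have s2 : (Metric.thickening (2 * r) Cᶜ)ᶜ ⊆ {y | y + ε • z ∈ F} := tr_s4 hzr
        have t1 := measureReal_mono (μ := μ) s1
        have t2 := measureReal_mono (μ := γ) s2
        have t3 := (hshell C hC (2 * r) (by positivity)).2
        simp only [Pi.sub_apply]
        linarith
      · intro z _
        have := (abs_le.1 (htr F hFc hFm hFb z)).2
        have h2 := mul_le_mul_of_nonneg_left (hW3 F C hFd) ha0
        simp only [Pi.sub_apply]
        linarith
      · have e := (neg_le_abs _).trans ((hI F hFm hFb))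
        rw [← integral_neg] at e
        simp only [neg_sub] at e
        refine e.trans ?_
        gcongr
        exact hV3 F C hFb hFd
  have hfin : a ≤ a / 2 + (2 * Q * R + 2 * 3 ^ d * vb * M) * ε := by
    refine ciSup_le fun C => ?_
    rw [div_le_iff₀ (by linarith [hW1 C.1])]
    exact hstep C.1 C.2.1 C.2.2.1 C.2.2.2
  refine (hP C hC hCm hCb).trans ?_
  refine mul_le_mul_of_nonneg_right ?_ (by linarith [hW1 C])
  linarith

end smoothing

section kernel
variable {d : ℕ}
open scoped FourierTransform

/-- squared modulus of the Fourier transform -/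
def kfun (g : EuclideanSpace ℝ (Fin d) → ℝ) (u : EuclideanSpace ℝ (Fin d)) : ℝ :=
  ‖𝓕 (fun x => (g x : ℂ)) u‖ ^ 2

lemma exists_bump {ρ : ℝ} (hρ : 0 < ρ) : ∃ g : EuclideanSpace ℝ (Fin d) → ℝ, Continuous g ∧
    (∀ x, 0 ≤ g x) ∧ (∀ x, g x ≤ 1) ∧ (∀ x, ρ ≤ ‖x‖ → g x = 0) ∧ Integrable g ∧
    Continuous (kfun g) ∧ Integrable (kfun g) ∧ 0 < ∫ u, kfun g u := by
  let b : ContDiffBump (0 : EuclideanSpace ℝ (Fin d)) := ⟨ρ / 2, ρ, by positivity, by linarith⟩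
  have hcs : HasCompactSupport (fun x => ((b x : ℝ) : ℂ)) :=
    b.hasCompactSupport.comp_left (g := fun r : ℝ => (r : ℂ)) (by simp)
  have hcd : ContDiff ℝ (⊤ : ℕ∞) (fun x => ((b x : ℝ) : ℂ)) :=
    Complex.ofRealCLM.contDiff.comp b.contDiff
  let f := hcs.toSchwartzMap hcd
  have hk : kfun b = fun u => ‖(𝓕 f : SchwartzMap _ _) u‖ ^ 2 := by
    ext u
    simp only [kfun]
    rw [SchwartzMap.fourier_coe]
    rfl
  refine ⟨b, b.continuous, fun x => b.nonneg, fun x => b.le_one, ?_,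
    b.continuous.integrable_of_hasCompactSupport b.hasCompactSupport, ?_, ?_, ?_⟩
  · intro x hx
    apply b.zero_of_le_dist
    simpa [b] using hx
  · rw [hk]; exact (SchwartzMap.continuous _).norm.pow 2
  · rw [hk]
    exact (memLp_two_iff_integrable_sq_norm (SchwartzMap.continuous _).aestronglyMeasurable).1
      ((𝓕 f : SchwartzMap _ _).memLp 2)
  · rw [hk, SchwartzMap.integral_norm_sq_fourier]
    have hcont : Continuous fun x => ‖f x‖ ^ 2 := f.continuous.norm.pow 2
    refine hcont.integral_pos_of_hasCompactSupport_nonneg_nonzero ?_ (fun x => by positivity)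
      (x := 0) ?_
    · exact (hcs.norm).comp_left (g := fun r : ℝ => r ^ 2) (by simp)
    · have : f 0 = ((b 0 : ℝ) : ℂ) := rfl
      rw [this, b.one_of_mem_closedBall (by simp [b]; positivity)]
      simp

lemma kfun_eq {g : EuclideanSpace ℝ (Fin d) → ℝ}
    (u : EuclideanSpace ℝ (Fin d)) :
    (kfun g u : ℂ) = ∫ p : EuclideanSpace ℝ (Fin d) × EuclideanSpace ℝ (Fin d),
      ((g p.1 * g p.2 : ℝ) : ℂ) * Complex.exp (Complex.I * ((2 * Real.pi * inner ℝ (p.2 - p.1) u : ℝ) : ℂ)) := by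
  have h1 : (kfun g u : ℂ) = 𝓕 (fun x => (g x : ℂ)) u * (starRingEnd ℂ) (𝓕 (fun x => (g x : ℂ)) u) := by
    rw [Complex.mul_conj, Complex.normSq_eq_norm_sq]; rfl
  rw [h1, Real.fourier_eq', ← integral_conj, ← integral_prod_mul]
  rw [← Measure.volume_eq_prod]
  refine integral_congr_ae (ae_of_all _ fun p => ?_)
  simp only [smul_eq_mul, map_mul, Complex.conj_ofReal, ← Complex.exp_conj, Complex.conj_I]
  rw [inner_sub_left]
  push_cast
  rw [mul_mul_mul_comm, ← Complex.exp_add, mul_comm]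
  congr 2
  ring

lemma kernel_int_mu {g : EuclideanSpace ℝ (Fin d) → ℝ} (hg : Continuous g) (hgi : Integrable g)
    (ε : ℝ) (x : EuclideanSpace ℝ (Fin d))
    (μ : Measure (EuclideanSpace ℝ (Fin d))) [IsFiniteMeasure μ] :
    Integrable (fun p : EuclideanSpace ℝ (Fin d) × EuclideanSpace ℝ (Fin d) =>
      ((g p.1 * g p.2 : ℝ) : ℂ) *
      Complex.exp (Complex.I * ((2 * Real.pi * inner ℝ (p.2 - p.1) (ε⁻¹ • x) : ℝ) : ℂ)) *
      ∫ y, Complex.exp (Complex.I * ((inner ℝ ((2 * Real.pi * ε⁻¹) • (p.1 - p.2)) y : ℝ) : ℂ)) ∂μ) ∧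
    ((∫ y, kfun g (ε⁻¹ • (x - y)) ∂μ : ℝ) : ℂ) =
    ∫ p : EuclideanSpace ℝ (Fin d) × EuclideanSpace ℝ (Fin d),
      ((g p.1 * g p.2 : ℝ) : ℂ) *
      Complex.exp (Complex.I * ((2 * Real.pi * inner ℝ (p.2 - p.1) (ε⁻¹ • x) : ℝ) : ℂ)) *
      ∫ y, Complex.exp (Complex.I * ((inner ℝ ((2 * Real.pi * ε⁻¹) • (p.1 - p.2)) y : ℝ) : ℂ)) ∂μ := by
  have hG : Integrable (fun p : EuclideanSpace ℝ (Fin d) × EuclideanSpace ℝ (Fin d) =>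
      ((g p.1 * g p.2 : ℝ) : ℂ)) (volume.prod volume) := (hgi.mul_prod hgi).ofReal
  have hint : Integrable (Function.uncurry fun (p : EuclideanSpace ℝ (Fin d) × EuclideanSpace ℝ (Fin d))
      (y : EuclideanSpace ℝ (Fin d)) =>
      ((g p.1 * g p.2 : ℝ) : ℂ) *
      Complex.exp (Complex.I * ((2 * Real.pi * inner ℝ (p.2 - p.1) (ε⁻¹ • x) : ℝ) : ℂ)) *
      Complex.exp (Complex.I * ((inner ℝ ((2 * Real.pi * ε⁻¹) • (p.1 - p.2)) y : ℝ) : ℂ)))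
      ((volume.prod volume).prod μ) := by
    have hG2 := hG.mul_prod (integrable_const (1 : ℂ) (μ := μ))
    refine hG2.mono ?_ (ae_of_all _ fun q => ?_)
    · apply Continuous.aestronglyMeasurable
      unfold Function.uncurry
      fun_prop
    · simp only [Function.uncurry, norm_mul, mul_comm Complex.I, Complex.norm_exp_ofReal_mul_I,
        mul_one, le_refl]
  have key : ∀ (p : EuclideanSpace ℝ (Fin d) × EuclideanSpace ℝ (Fin d)) y,
      ((g p.1 * g p.2 : ℝ) : ℂ) * Complex.exp (Complex.I *
        ((2 * Real.pi * inner ℝ (p.2 - p.1) (ε⁻¹ • (x - y)) : ℝ) : ℂ)) =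
      ((g p.1 * g p.2 : ℝ) : ℂ) *
      Complex.exp (Complex.I * ((2 * Real.pi * inner ℝ (p.2 - p.1) (ε⁻¹ • x) : ℝ) : ℂ)) *
      Complex.exp (Complex.I * ((inner ℝ ((2 * Real.pi * ε⁻¹) • (p.1 - p.2)) y : ℝ) : ℂ)) := by
    intro p y
    rw [mul_assoc (((g p.1 * g p.2 : ℝ) : ℂ)) _ (Complex.exp _), ← Complex.exp_add, ← mul_add]
    congr 3
    rw [smul_sub, inner_sub_right, inner_smul_right, inner_smul_right, inner_smul_left,
      ← neg_sub p.2 p.1, inner_neg_left]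
    push_cast
    simp
    ring
  refine ⟨?_, ?_⟩
  · have := hint.integral_prod_left
    simp only [Function.uncurry, integral_const_mul] at this
    exact this
  · rw [← integral_complex_ofReal]
    simp_rw [kfun_eq, key]
    rw [Measure.volume_eq_prod, ← integral_integral_swap hint]
    simp_rw [integral_const_mul]

lemma kernel_diff {g : EuclideanSpace ℝ (Fin d) → ℝ} {ρ ε : ℝ} (hε : 0 < ε) (hg : Continuous g)
    (hg0 : ∀ x, 0 ≤ g x) (hg1 : ∀ x, g x ≤ 1) (hgs : ∀ x, ρ ≤ ‖x‖ → g x = 0)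
    (hgi : Integrable g) (Φ : EuclideanSpace ℝ (Fin d) → ℝ)
    (hΦ0 : ∀ x, 0 ≤ Φ x) (hΦi : Integrable Φ) (hΦc : Continuous Φ)
    (μ γ : Measure (EuclideanSpace ℝ (Fin d))) [IsFiniteMeasure μ] [IsFiniteMeasure γ]
    (hcl : ∀ η : EuclideanSpace ℝ (Fin d), ‖η‖ ≤ 4 * Real.pi * ρ / ε →
      ‖∫ y, Complex.exp (Complex.I * ((inner ℝ η y : ℝ) : ℂ)) ∂μ -
        ∫ y, Complex.exp (Complex.I * ((inner ℝ η y : ℝ) : ℂ)) ∂γ‖ ≤ ε * Φ η)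
    (x : EuclideanSpace ℝ (Fin d)) :
    |∫ y, kfun g (ε⁻¹ • (x - y)) ∂μ - ∫ y, kfun g (ε⁻¹ • (x - y)) ∂γ| ≤
      ε ^ (d + 1) * (((2 * Real.pi) ^ d)⁻¹ * (∫ x, g x) * ∫ η, Φ η) := by
  obtain ⟨i1, e1⟩ := kernel_int_mu hg hgi ε x μ
  obtain ⟨i2, e2⟩ := kernel_int_mu hg hgi ε x γ
  have hnorm : |∫ y, kfun g (ε⁻¹ • (x - y)) ∂μ - ∫ y, kfun g (ε⁻¹ • (x - y)) ∂γ| =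
      ‖((∫ y, kfun g (ε⁻¹ • (x - y)) ∂μ : ℝ) : ℂ) - ((∫ y, kfun g (ε⁻¹ • (x - y)) ∂γ : ℝ) : ℂ)‖ := by
    rw [← Complex.ofReal_sub, Complex.norm_real, Real.norm_eq_abs]
  rw [hnorm, e1, e2, ← integral_sub i1 i2]
  simp_rw [← mul_sub]
  have hπ : 0 < 2 * Real.pi * ε⁻¹ := by positivity
  -- integrability of the majorant
  have hshift : ∀ a : EuclideanSpace ℝ (Fin d),
      Integrable (fun p => Φ ((2 * Real.pi * ε⁻¹) • (p - a))) ∧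
      ∫ p, Φ ((2 * Real.pi * ε⁻¹) • (p - a)) = ε ^ d * ((2 * Real.pi) ^ d)⁻¹ * ∫ η, Φ η := by
    intro a
    constructor
    · exact ((integrable_comp_smul_iff volume Φ hπ.ne').2 hΦi).comp_sub_right a
    · rw [integral_sub_right_eq_self (fun p => Φ ((2 * Real.pi * ε⁻¹) • p)) a,
        Measure.integral_comp_smul]
      simp only [finrank_euclideanSpace, Fintype.card_fin, smul_eq_mul]
      rw [abs_of_pos (by positivity), mul_pow, mul_inv, inv_pow, inv_inv]
      ring
  have hmaj : Integrable (fun p : EuclideanSpace ℝ (Fin d) × EuclideanSpace ℝ (Fin d) =>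
      g p.2 * (ε * Φ ((2 * Real.pi * ε⁻¹) • (p.1 - p.2)))) (volume.prod volume) := by
    rw [integrable_prod_iff' (by
      apply Continuous.aestronglyMeasurable; fun_prop)]
    constructor
    · exact ae_of_all _ fun a => (((hshift a).1.const_mul ε).const_mul (g a))
    · have : ∀ a, ∫ p, ‖g a * (ε * Φ ((2 * Real.pi * ε⁻¹) • (p - a)))‖ =
          g a * (ε * (ε ^ d * ((2 * Real.pi) ^ d)⁻¹ * ∫ η, Φ η)) := by
        intro a
        rw [← (hshift a).2, ← integral_const_mul, ← integral_const_mul]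
        refine integral_congr_ae (ae_of_all _ fun p => ?_)
        simp only
        rw [Real.norm_of_nonneg]
        exact mul_nonneg (hg0 _) (mul_nonneg hε.le (hΦ0 _))
      simp_rw [this]
      exact hgi.mul_const _
  refine (norm_integral_le_of_norm_le hmaj (ae_of_all _ fun p => ?_)).trans (le_of_eq ?_)
  · rw [norm_mul, norm_mul, mul_comm Complex.I, Complex.norm_exp_ofReal_mul_I, mul_one,
      Complex.norm_real, Real.norm_of_nonneg (mul_nonneg (hg0 _) (hg0 _))]
    by_cases h1 : ρ ≤ ‖p.1‖
    · rw [hgs _ h1]; simp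
      exact mul_nonneg (hg0 _) (mul_nonneg hε.le (hΦ0 _))
    by_cases h2 : ρ ≤ ‖p.2‖
    · rw [hgs _ h2]; simp
    push Not at h1 h2
    have := hcl ((2 * Real.pi * ε⁻¹) • (p.1 - p.2)) (by
      rw [norm_smul, Real.norm_of_nonneg hπ.le]
      have h3 := norm_sub_le p.1 p.2
      have : ‖p.1 - p.2‖ ≤ 2 * ρ := by linarith
      calc 2 * Real.pi * ε⁻¹ * ‖p.1 - p.2‖ ≤ 2 * Real.pi * ε⁻¹ * (2 * ρ) := by gcongr
        _ = _ := by field_simp; ring)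
    calc _ ≤ (1 * g p.2) * (ε * Φ ((2 * Real.pi * ε⁻¹) • (p.1 - p.2))) := by
          refine mul_le_mul ?_ this (norm_nonneg _) (by rw [one_mul]; exact hg0 _)
          exact mul_le_mul_of_nonneg_right (hg1 _) (hg0 _)
      _ = _ := by rw [one_mul]
  · rw [integral_prod_symm _ hmaj]
    simp_rw [integral_const_mul, (hshift _).2, integral_mul_const]
    ring

end kernel

section convk
variable {d : ℕ}
open scoped FourierTransform

lemma kfun_nonneg (g : EuclideanSpace ℝ (Fin d) → ℝ) (u) : 0 ≤ kfun g u := by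
  unfold kfun; positivity

lemma kfun_le (g : EuclideanSpace ℝ (Fin d) → ℝ) (u) : kfun g u ≤ (∫ x, ‖(g x : ℂ)‖) ^ 2 := by
  unfold kfun
  refine pow_le_pow_left₀ (norm_nonneg _) ?_ 2
  exact VectorFourier.norm_fourierIntegral_le_integral_norm _ _ _ _ _

lemma conv_id {k : EuclideanSpace ℝ (Fin d) → ℝ} (hkc : Continuous k) (hki : Integrable k)
    {Mk : ℝ} (hkb : ∀ u, ‖k u‖ ≤ Mk) {ε : ℝ} (hε : 0 < ε)
    (μ : Measure (EuclideanSpace ℝ (Fin d))) [IsFiniteMeasure μ]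
    {F : Set (EuclideanSpace ℝ (Fin d))} (hF : MeasurableSet F) (hFb : Bornology.IsBounded F) :
    Integrable (fun x => ∫ y, k (ε⁻¹ • (x - y)) ∂μ) (volume.restrict F) ∧
    ∫ z, k z * μ.real {y | y + ε • z ∈ F} = (ε ^ d)⁻¹ * ∫ x in F, ∫ y, k (ε⁻¹ • (x - y)) ∂μ := by
  have hFv : IsFiniteMeasure (volume.restrict F) := ⟨by
    rw [Measure.restrict_apply_univ]; exact hFb.measure_lt_top⟩
  have hint1 : Integrable (Function.uncurry fun (x y : EuclideanSpace ℝ (Fin d)) =>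
      k (ε⁻¹ • (x - y))) ((volume.restrict F).prod μ) := by
    refine Integrable.of_bound (C := Mk) ?_ (ae_of_all _ fun p => hkb _)
    apply Continuous.aestronglyMeasurable
    unfold Function.uncurry
    fun_prop
  refine ⟨hint1.integral_prod_left, ?_⟩
  have hS : MeasurableSet {p : EuclideanSpace ℝ (Fin d) × EuclideanSpace ℝ (Fin d) |
      p.2 + ε • p.1 ∈ F} := by
    have : Measurable fun p : EuclideanSpace ℝ (Fin d) × EuclideanSpace ℝ (Fin d) =>
      p.2 + ε • p.1 := by fun_prop
    exact this hF
  have hint2 : Integrable (Function.uncurry fun (z y : EuclideanSpace ℝ (Fin d)) =>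
      k z * F.indicator (fun _ => (1 : ℝ)) (y + ε • z)) (volume.prod μ) := by
    have h0 := (hki.mul_prod (integrable_const (1 : ℝ) (μ := μ))).indicator hS
    refine h0.congr (ae_of_all _ fun p => ?_)
    by_cases hp : p.2 + ε • p.1 ∈ F
    · simp [Function.uncurry, Set.indicator, hp]
    · simp [Function.uncurry, Set.indicator, hp]
  have e1 : ∀ z, k z * μ.real {y | y + ε • z ∈ F} =
      ∫ y, k z * F.indicator (fun _ => (1 : ℝ)) (y + ε • z) ∂μ := by
    intro z
    rw [integral_const_mul]
    congr 1
    have hm : MeasurableSet {y | y + ε • z ∈ F} := (measurable_id.add_const (ε • z)) hF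
    rw [← integral_indicator_one hm]
    rfl
  have e2 : ∀ y, ∫ z, k z * F.indicator (fun _ => (1 : ℝ)) (y + ε • z) =
      (ε ^ d)⁻¹ * ∫ x in F, k (ε⁻¹ • (x - y)) := by
    intro y
    have h1 := Measure.integral_comp_smul (volume : Measure (EuclideanSpace ℝ (Fin d)))
      (fun w => k (ε⁻¹ • w) * F.indicator (fun _ => (1 : ℝ)) (y + w)) ε
    simp only [smul_smul, inv_mul_cancel₀ hε.ne', one_smul, finrank_euclideanSpace,
      Fintype.card_fin, smul_eq_mul] at h1
    rw [h1, abs_of_pos (by positivity)]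
    congr 1
    have h2 := integral_sub_right_eq_self (μ := (volume : Measure (EuclideanSpace ℝ (Fin d))))
      (fun w => k (ε⁻¹ • w) * F.indicator (fun _ => (1 : ℝ)) (y + w)) y
    rw [← h2, ← integral_indicator hF]
    refine integral_congr_ae (ae_of_all _ fun x => ?_)
    by_cases hx : x ∈ F <;> simp [Set.indicator, hx]
  simp_rw [e1]
  rw [integral_integral_swap hint2]
  simp_rw [e2]
  rw [integral_const_mul, integral_integral_swap hint1]

lemma kernel_bound (ρ : ℝ) (hρ : 0 < ρ) :
    ∃ (κ : Measure (EuclideanSpace ℝ (Fin d))) (c : ℝ), IsProbabilityMeasure κ ∧ 0 ≤ c ∧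
    ∀ (Φ : EuclideanSpace ℝ (Fin d) → ℝ)
    (_ : ∀ x, 0 ≤ Φ x) (_ : Integrable Φ) (_ : Continuous Φ) (ε : ℝ) (_ : 0 < ε)
    (μ γ : Measure (EuclideanSpace ℝ (Fin d))) (_ : IsFiniteMeasure μ) (_ : IsFiniteMeasure γ)
    (_ : ∀ η : EuclideanSpace ℝ (Fin d), ‖η‖ ≤ 4 * Real.pi * ρ / ε →
      ‖∫ y, Complex.exp (Complex.I * ((inner ℝ η y : ℝ) : ℂ)) ∂μ -
        ∫ y, Complex.exp (Complex.I * ((inner ℝ η y : ℝ) : ℂ)) ∂γ‖ ≤ ε * Φ η),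
    ∀ F : Set (EuclideanSpace ℝ (Fin d)), MeasurableSet F → Bornology.IsBounded F →
      |∫ z, (μ.real {y | y + ε • z ∈ F} - γ.real {y | y + ε • z ∈ F}) ∂κ| ≤
        volume.real F * (c * ∫ η, Φ η) * ε := by
  obtain ⟨g, hg, hg0, hg1, hgs, hgi, hkc, hki, hkpos⟩ := exists_bump (d := d) hρ
  set Z := ∫ u, kfun g u with hZ
  have hk0 := kfun_nonneg g
  set κ : Measure (EuclideanSpace ℝ (Fin d)) :=
    volume.withDensity (fun z => ENNReal.ofReal (kfun g z / Z)) with hκ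
  have hkm : Measurable fun z => ENNReal.ofReal (kfun g z / Z) :=
    (hkc.measurable.div_const _).ennreal_ofReal
  have hprob : IsProbabilityMeasure κ := by
    constructor
    rw [hκ, withDensity_apply _ MeasurableSet.univ, Measure.restrict_univ,
      ← ofReal_integral_eq_lintegral_ofReal (hki.div_const _)
        (ae_of_all _ fun z => div_nonneg (hk0 z) hkpos.le), integral_div, ← hZ,
      div_self hkpos.ne']
    simp
  have hg00 : 0 ≤ ∫ x, g x := integral_nonneg hg0
  refine ⟨κ, Z⁻¹ * (((2 * Real.pi) ^ d)⁻¹ * (∫ x, g x)), hprob, by positivity, ?_⟩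
  intro Φ hΦ0 hΦi hΦc ε hε μ γ _ _ hcl F hF hFb
  have hdiff := kernel_diff hε hg hg0 hg1 hgs hgi Φ hΦ0 hΦi hΦc μ γ hcl
  have hb : ∀ u, ‖kfun g u‖ ≤ (∫ x, ‖(g x : ℂ)‖) ^ 2 := fun u => by
    rw [Real.norm_of_nonneg (hk0 u)]; exact kfun_le g u
  obtain ⟨i1, e1⟩ := conv_id hkc hki hb hε μ hF hFb
  obtain ⟨i2, e2⟩ := conv_id hkc hki hb hε γ hF hFb
  have hS : MeasurableSet {p : EuclideanSpace ℝ (Fin d) × EuclideanSpace ℝ (Fin d) |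
      p.2 + ε • p.1 ∈ F} := by
    have : Measurable fun p : EuclideanSpace ℝ (Fin d) × EuclideanSpace ℝ (Fin d) =>
      p.2 + ε • p.1 := by fun_prop
    exact this hF
  have hki' : ∀ ν : Measure (EuclideanSpace ℝ (Fin d)), IsFiniteMeasure ν →
      Integrable (fun z => kfun g z * ν.real {y | y + ε • z ∈ F}) := by
    intro ν _
    have hm : Measurable fun z => ν.real {y | y + ε • z ∈ F} :=
      (measurable_measure_prodMk_left (ν := ν) hS).ennreal_toReal
    refine hki.mul_bdd (c := ν.real Set.univ) hm.aestronglyMeasurable (ae_of_all _ fun z => ?_)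
    rw [Real.norm_eq_abs, abs_of_nonneg measureReal_nonneg]
    exact measureReal_mono (Set.subset_univ _)
  have hfin : ∀ᵐ z : EuclideanSpace ℝ (Fin d), ENNReal.ofReal (kfun g z / Z) < ⊤ :=
    ae_of_all _ fun z => ENNReal.ofReal_lt_top
  have e3 : ∫ z, (μ.real {y | y + ε • z ∈ F} - γ.real {y | y + ε • z ∈ F}) ∂κ =
      Z⁻¹ * ((ε ^ d)⁻¹ * ∫ x in F, (∫ y, kfun g (ε⁻¹ • (x - y)) ∂μ -
        ∫ y, kfun g (ε⁻¹ • (x - y)) ∂γ)) := by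
    rw [hκ, integral_withDensity_eq_integral_toReal_smul hkm hfin, integral_sub i1 i2, mul_sub,
      ← e1, ← e2, ← integral_sub (hki' μ inferInstance) (hki' γ inferInstance),
      ← integral_const_mul]
    refine integral_congr_ae (ae_of_all _ fun z => ?_)
    simp only [smul_eq_mul]
    rw [ENNReal.toReal_ofReal (div_nonneg (hk0 z) hkpos.le)]
    ring
  have hbound := norm_setIntegral_le_of_norm_le_const (μ := volume) (s := F) hFb.measure_lt_top
    (f := fun x => (∫ y, kfun g (ε⁻¹ • (x - y)) ∂μ - ∫ y, kfun g (ε⁻¹ • (x - y)) ∂γ))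
    (fun x _ => hdiff x)
  rw [e3, abs_mul, abs_mul, abs_of_pos (inv_pos.2 hkpos), abs_of_pos (by positivity : 0 < (ε ^ d)⁻¹)]
  rw [Real.norm_eq_abs] at hbound
  calc Z⁻¹ * ((ε ^ d)⁻¹ * _) ≤ Z⁻¹ * ((ε ^ d)⁻¹ * (ε ^ (d + 1) *
        (((2 * Real.pi) ^ d)⁻¹ * (∫ x, g x) * ∫ η, Φ η) * volume.real F)) := by gcongr
    _ = _ := by
      rw [pow_succ]
      field_simp

end convk

section fclose
variable {d : ℕ} {K : Matrix (Fin d) (Fin d) ℝ}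

lemma qf_coercive (hd : 0 < d) (hK : K.PosDef) :
    ∃ c : ℝ, 0 < c ∧ ∀ η : EuclideanSpace ℝ (Fin d), 2 * c * ‖η‖ ^ 2 ≤ qf K η := by
  have hcont : Continuous (qf K) := by unfold qf; fun_prop
  have hpos : ∀ η : EuclideanSpace ℝ (Fin d), η ≠ 0 → 0 < qf K η := by
    intro η hη
    have h := hK.dotProduct_mulVec_pos (x := η.ofLp) (by
      intro h; apply hη; ext i; simp [h])
    have e : dotProduct (star η.ofLp) (K.mulVec η.ofLp) = qf K η := by
      simp only [dotProduct, Matrix.mulVec, qf, Finset.mul_sum, Pi.star_apply, star_trivial, mul_assoc]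
    rwa [e] at h
  have hne : (Metric.sphere (0 : EuclideanSpace ℝ (Fin d)) 1).Nonempty := by
    have : Nonempty (Fin d) := ⟨⟨0, hd⟩⟩
    exact (NormedSpace.sphere_nonempty (x := (0 : EuclideanSpace ℝ (Fin d))) (r := 1)).2 zero_le_one
  obtain ⟨x0, hx0, hmin⟩ := (isCompact_sphere (0 : EuclideanSpace ℝ (Fin d)) 1).exists_isMinOn hne
    hcont.continuousOn
  have hx0' : x0 ≠ 0 := by
    intro h
    rw [h] at hx0
    simp at hx0
  refine ⟨qf K x0 / 2, by have := hpos x0 hx0'; positivity, fun η => ?_⟩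
  by_cases hη : η = 0
  · simp [hη, qf]
  have hn : 0 < ‖η‖ := norm_pos_iff.2 hη
  have h1 : qf K x0 ≤ qf K (‖η‖⁻¹ • η) := hmin (by
    simp [norm_smul, hn.ne'])
  have h2 : qf K (‖η‖⁻¹ • η) = (‖η‖ ^ 2)⁻¹ * qf K η := by
    simp only [qf, Finset.mul_sum]
    refine Finset.sum_congr rfl fun i _ => Finset.sum_congr rfl fun j _ => ?_
    simp
    ring
  rw [h2] at h1
  calc 2 * (qf K x0 / 2) * ‖η‖ ^ 2 = qf K x0 * ‖η‖ ^ 2 := by ring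
    _ ≤ ((‖η‖ ^ 2)⁻¹ * qf K η) * ‖η‖ ^ 2 := by gcongr
    _ = qf K η := by field_simp

lemma re_quad (h : Fin d → ℝ) (η : EuclideanSpace ℝ (Fin d)) :
    ((∑ i, ∑ j, ((h i : ℂ) + Complex.I * (η i : ℂ)) * ((h j : ℂ) + Complex.I * (η j : ℂ)) *
      (K i j : ℂ)) / 2).re = (∑ i, ∑ j, h i * h j * K i j) / 2 - qf K η / 2 := by
  have : ((2 : ℂ)) = ((2 : ℝ) : ℂ) := by simp
  rw [this, Complex.div_ofReal_re, ← sub_div, Complex.re_sum]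
  congr 1
  simp only [qf, Complex.re_sum, ← Finset.sum_sub_distrib]
  refine Finset.sum_congr rfl fun i _ => Finset.sum_congr rfl fun j _ => ?_
  simp
  ring

lemma norm_sum_z (h : Fin d → ℝ) (η : EuclideanSpace ℝ (Fin d)) :
    ∑ i, ‖(h i : ℂ) + Complex.I * (η i : ℂ)‖ ≤ ∑ i, |h i| + d * ‖η‖ := by
  calc ∑ i, ‖(h i : ℂ) + Complex.I * (η i : ℂ)‖ ≤ ∑ i, (|h i| + ‖η‖) := by
        refine Finset.sum_le_sum fun i _ => (norm_add_le _ _).trans ?_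
        rw [norm_mul, Complex.norm_I, one_mul, Complex.norm_real, Complex.norm_real]
        exact add_le_add le_rfl (PiLp.norm_apply_le η i)
    _ = _ := by rw [Finset.sum_add_distrib]; simp

lemma fourier_close (hd : 0 < d) (hK : K.PosDef) (b c a : ℝ) (hb : 0 ≤ b) (hc : 0 ≤ c) (ha : 0 ≤ a)
    (h : Fin d → ℝ) :
    ∃ c0 ε0 Cφ c2 : ℝ, 0 < c0 ∧ 0 < ε0 ∧ 0 ≤ Cφ ∧ 0 < c2 ∧
    ∀ ε : ℝ, 0 < ε → ε ≤ ε0 → ∀ η : EuclideanSpace ℝ (Fin d), ‖η‖ ≤ c0 / ε →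
      a * (∑ i, ‖(h i : ℂ) + Complex.I * (η i : ℂ)‖) * ε ≤ 1 ∧
      ∀ R : ℂ, ‖R‖ ≤ (b * (∑ i, ‖(h i : ℂ) + Complex.I * (η i : ℂ)‖) ^ 2 +
        c * (∑ i, ‖(h i : ℂ) + Complex.I * (η i : ℂ)‖) ^ 3) * ε →
      ‖Complex.exp ((∑ i, ∑ j, ((h i : ℂ) + Complex.I * (η i : ℂ)) *
        ((h j : ℂ) + Complex.I * (η j : ℂ)) * (K i j : ℂ)) / 2 + R) -
        Complex.exp ((∑ i, ∑ j, ((h i : ℂ) + Complex.I * (η i : ℂ)) *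
        ((h j : ℂ) + Complex.I * (η j : ℂ)) * (K i j : ℂ)) / 2)‖ ≤
      ε * (Cφ * Real.exp (-c2 * ‖η‖ ^ 2)) := by
  obtain ⟨c1, hc1, hcoer⟩ := qf_coercive hd hK
  set H := ∑ i, |h i| with hH
  have hH0 : 0 ≤ H := Finset.sum_nonneg fun _ _ => abs_nonneg _
  have hd' : (0 : ℝ) < d := by exact_mod_cast hd
  set τ := c1 / (4 * d ^ 2) with hτ
  have hτ0 : 0 < τ := by positivity
  -- choose the constants
  set c0 := min (τ / (4 * (c * d + 1))) (1 / (2 * (a * d + 1))) with hc0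
  set ε0 := min (τ / (4 * (b + c * H + 1))) (1 / (2 * (a * H + 1))) with hε0
  set qh := (∑ i, ∑ j, h i * h j * K i j) / 2 with hqh
  set C := Real.exp (qh + 2 * τ * H ^ 2) * ((2 * b + 6 * c) * Real.exp (H + d ^ 2 / c1)) with hC
  have cp0 : 0 < c0 := by rw [hc0]; positivity
  have ep0 : 0 < ε0 := by rw [hε0]; positivity
  refine ⟨c0, ε0, C, c1 / 4, cp0, ep0, by positivity, by positivity, ?_⟩
  intro ε hε hεε0 η hη
  set s := ∑ i, ‖(h i : ℂ) + Complex.I * (η i : ℂ)‖ with hs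
  have hs0 : 0 ≤ s := Finset.sum_nonneg fun _ _ => norm_nonneg _
  have hsn : s ≤ H + d * ‖η‖ := norm_sum_z h η
  set n := ‖η‖ with hn
  have hn0 : 0 ≤ n := norm_nonneg _
  have hnε : n * ε ≤ c0 := by rwa [le_div_iff₀ hε] at hη
  have c0a : c0 * (4 * (c * d + 1)) ≤ τ := by
    rw [← le_div_iff₀ (by positivity)]; exact min_le_left _ _
  have c0b : c0 * (2 * (a * d + 1)) ≤ 1 := by
    rw [← le_div_iff₀ (by positivity)]; exact min_le_right _ _
  have e0a : ε * (4 * (b + c * H + 1)) ≤ τ := by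
    rw [← le_div_iff₀ (by positivity)]; exact hεε0.trans (min_le_left _ _)
  have e0b : ε * (2 * (a * H + 1)) ≤ 1 := by
    rw [← le_div_iff₀ (by positivity)]; exact hεε0.trans (min_le_right _ _)
  have hsε : s * ε ≤ H * ε + d * c0 := by
    calc s * ε ≤ (H + d * n) * ε := by gcongr
      _ = H * ε + d * (n * ε) := by ring
      _ ≤ _ := by gcongr
  refine ⟨?_, fun R hR => ?_⟩
  · have := mul_le_mul_of_nonneg_left hsε ha
    nlinarith
  have hRτ : ‖R‖ ≤ 2 * τ * H ^ 2 + c1 / 2 * n ^ 2 := by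
    have h1 : (b + c * s) * ε ≤ τ := by
      have := mul_le_mul_of_nonneg_left hsε hc
      nlinarith
    have h2 : ‖R‖ ≤ τ * s ^ 2 := by
      refine hR.trans ?_
      calc (b * s ^ 2 + c * s ^ 3) * ε = ((b + c * s) * ε) * s ^ 2 := by ring
        _ ≤ _ := by gcongr
    have h3 : s ^ 2 ≤ 2 * H ^ 2 + 2 * (d * n) ^ 2 := by
      have : s ^ 2 ≤ (H + d * n) ^ 2 := by gcongr
      nlinarith [sq_nonneg (H - d * n)]
    calc ‖R‖ ≤ τ * s ^ 2 := h2
      _ ≤ τ * (2 * H ^ 2 + 2 * (d * n) ^ 2) := by gcongr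
      _ = _ := by rw [hτ]; field_simp; ring
  have hpoly : b * s ^ 2 + c * s ^ 3 ≤ (2 * b + 6 * c) * Real.exp (H + d ^ 2 / c1) *
      Real.exp (c1 / 4 * n ^ 2) := by
    have p2 : s ^ 2 ≤ 2 * Real.exp s := by
      have := Real.pow_div_factorial_le_exp s hs0 2
      simp [Nat.factorial] at this; linarith
    have p3 : s ^ 3 ≤ 6 * Real.exp s := by
      have := Real.pow_div_factorial_le_exp s hs0 3
      simp [Nat.factorial] at this; linarith
    have p4 : Real.exp s ≤ Real.exp (H + d ^ 2 / c1) * Real.exp (c1 / 4 * n ^ 2) := by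
      rw [← Real.exp_add]
      apply Real.exp_le_exp.2
      have : d * n ≤ d ^ 2 / c1 + c1 / 4 * n ^ 2 := by
        have e : (d : ℝ) ^ 2 / c1 + c1 / 4 * n ^ 2 - d * n = (d - c1 / 2 * n) ^ 2 / c1 := by
          field_simp; ring
        have : 0 ≤ (d - c1 / 2 * n) ^ 2 / c1 := by positivity
        linarith
      linarith
    calc b * s ^ 2 + c * s ^ 3 ≤ b * (2 * Real.exp s) + c * (6 * Real.exp s) := by gcongr
      _ = (2 * b + 6 * c) * Real.exp s := by ring
      _ ≤ (2 * b + 6 * c) * (Real.exp (H + d ^ 2 / c1) * Real.exp (c1 / 4 * n ^ 2)) := by gcongr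
      _ = _ := by ring
  set q := ((∑ i, ∑ j, ((h i : ℂ) + Complex.I * (η i : ℂ)) *
        ((h j : ℂ) + Complex.I * (η j : ℂ)) * (K i j : ℂ)) / 2) with hq
  have hre : q.re ≤ qh - c1 * n ^ 2 := by
    rw [hq, re_quad, ← hqh]
    have := hcoer η
    linarith
  have hexp : ‖Complex.exp R - 1‖ ≤ ‖R‖ * Real.exp ‖R‖ := by
    have := Complex.norm_exp_sub_sum_le_norm_mul_exp R 1
    simpa using this
  calc ‖Complex.exp (q + R) - Complex.exp q‖ = ‖Complex.exp q‖ * ‖Complex.exp R - 1‖ := by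
        rw [← norm_mul, mul_sub, ← Complex.exp_add, mul_one]
    _ ≤ Real.exp (qh - c1 * n ^ 2) * (((2 * b + 6 * c) * Real.exp (H + d ^ 2 / c1) *
      Real.exp (c1 / 4 * n ^ 2) * ε) * Real.exp (2 * τ * H ^ 2 + c1 / 2 * n ^ 2)) := by
        rw [Complex.norm_exp]
        gcongr
        refine hexp.trans ?_
        gcongr
        refine hR.trans ?_
        gcongr
    _ = ε * ((2 * b + 6 * c) * Real.exp (H + d ^ 2 / c1) * (Real.exp (qh - c1 * n ^ 2) * Real.exp (c1 / 4 * n ^ 2) *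
        Real.exp (2 * τ * H ^ 2 + c1 / 2 * n ^ 2))) := by ring
    _ = ε * ((2 * b + 6 * c) * Real.exp (H + d ^ 2 / c1) * (Real.exp (qh + 2 * τ * H ^ 2) * Real.exp (-(c1 / 4) * n ^ 2))) := by
        have hm : Real.exp (qh - c1 * n ^ 2) * Real.exp (c1 / 4 * n ^ 2) *
            Real.exp (2 * τ * H ^ 2 + c1 / 2 * n ^ 2) =
            Real.exp (qh + 2 * τ * H ^ 2) * Real.exp (-(c1 / 4) * n ^ 2) := by
          simp only [← Real.exp_add]
          congr 1
          ring
        rw [hm]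
    _ = _ := by rw [hC]; ring

end fclose

section perh
variable {d : ℕ} {K : Matrix (Fin d) (Fin d) ℝ}

lemma tilt_fin (h : Fin d → ℝ) (ν : Measure (EuclideanSpace ℝ (Fin d)))
    (hi : Integrable (fun y : EuclideanSpace ℝ (Fin d) => Real.exp (∑ i, h i * y i)) ν) :
    IsFiniteMeasure (tilt h ν) :=
  isFiniteMeasure_withDensity_ofReal hi.2

lemma tilt_cf (h : Fin d → ℝ) (ν : Measure (EuclideanSpace ℝ (Fin d)))
    (η : EuclideanSpace ℝ (Fin d)) :
    ∫ y, Complex.exp (Complex.I * ((inner ℝ η y : ℝ) : ℂ)) ∂(tilt h ν) =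
    ∫ y, Complex.exp (∑ i, ((h i : ℂ) + Complex.I * (η i : ℂ)) * (y i : ℂ)) ∂ν := by
  unfold tilt
  rw [integral_withDensity_eq_integral_toReal_smul]
  · congr 1
    ext y
    rw [ENNReal.toReal_ofReal (Real.exp_nonneg _), Complex.real_smul, Complex.ofReal_exp,
      ← Complex.exp_add]
    congr 1
    rw [PiLp.inner_apply]
    push_cast
    rw [Finset.mul_sum, ← Finset.sum_add_distrib]
    refine Finset.sum_congr rfl fun i _ => ?_
    simp
    ring
  · exact Measurable.ennreal_ofReal (Real.measurable_exp.comp (by fun_prop))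
  · exact ae_of_all _ fun _ => ENNReal.ofReal_lt_top

lemma exists_tail (κ : Measure (EuclideanSpace ℝ (Fin d))) [IsFiniteMeasure κ] (δ : ℝ)
    (hδ : 0 < δ) : ∃ R : ℝ, 0 < R ∧ κ.real {z | R ≤ ‖z‖} ≤ δ := by
  have ht : Tendsto (fun n : ℕ => κ {z | (n : ℝ) ≤ ‖z‖}) atTop
      (𝓝 (κ (⋂ n : ℕ, {z | (n : ℝ) ≤ ‖z‖}))) := by
    apply tendsto_measure_iInter_atTop
    · intro n
      exact (measurableSet_le measurable_const measurable_norm).nullMeasurableSet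
    · intro m n hmn z hz
      have hz' : (n : ℝ) ≤ ‖z‖ := hz
      have : (m : ℝ) ≤ n := by exact_mod_cast hmn
      exact this.trans hz'
    · exact ⟨0, measure_ne_top _ _⟩
  have he : (⋂ n : ℕ, {z : EuclideanSpace ℝ (Fin d) | (n : ℝ) ≤ ‖z‖}) = ∅ := by
    ext z
    simp only [Set.mem_iInter, Set.mem_empty_iff_false, iff_false, not_forall]
    obtain ⟨n, hn⟩ := exists_nat_gt ‖z‖
    exact ⟨n, fun hz => absurd (show (n : ℝ) ≤ ‖z‖ from hz) (not_le.2 hn)⟩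
  rw [he, measure_empty] at ht
  have h1 := ht.eventually (gt_mem_nhds (ENNReal.ofReal_pos.2 hδ))
  obtain ⟨n, hn, hn0⟩ := (h1.and (eventually_gt_atTop 0)).exists
  refine ⟨n, by exact_mod_cast hn0, ?_⟩
  rw [measureReal_def]
  exact ENNReal.toReal_le_of_le_ofReal hδ.le hn.le

/-- the law of the renormalised vector -/
abbrev lawY {Ω : Type} [MeasurableSpace Ω] (ℙ : Measure Ω) (S : Ω → EuclideanSpace ℝ (Fin d))
    (N D : ℝ) : Measure (EuclideanSpace ℝ (Fin d)) :=
  Measure.map (fun ω => (Real.sqrt (N * D))⁻¹ • S ω) ℙ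

lemma sum_linf {Ω : Type} [MeasurableSpace Ω] (S : Ω → EuclideanSpace ℝ (Fin d)) (c : ℝ)
    (z : Fin d → ℂ) (ω : Ω) :
    ∑ i, z i * (((c • S ω) i : ℝ) : ℂ) = linf S (fun i => (c : ℝ) * z i) ω := by
  unfold linf
  refine Finset.sum_congr rfl fun i _ => ?_
  simp
  ring

lemma per_h (hd : 0 < d) (hK : K.PosDef) {A B : ℝ} (hA : 0 < A) (hB : 0 < B) (h : Fin d → ℝ) :
    ∃ Ch εh : ℝ, 0 ≤ Ch ∧ 0 < εh ∧ IsFiniteMeasure (tilt h (gaussianMeasure d K)) ∧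
    ∀ (Ω : Type) (_ : MeasurableSpace Ω) (ℙ : Measure Ω) (_ : IsProbabilityMeasure ℙ)
      (S : Ω → EuclideanSpace ℝ (Fin d)) (N D : ℝ), MCHyp K A B ℙ S N D →
      Real.sqrt (D / N) ≤ εh →
      IsFiniteMeasure (tilt h (lawY ℙ S N D)) ∧
      ∀ C : Set (EuclideanSpace ℝ (Fin d)), Convex ℝ C → MeasurableSet C → Bornology.IsBounded C →
      |(tilt h (lawY ℙ S N D)).real C - (tilt h (gaussianMeasure d K)).real C| ≤
        Ch * Real.sqrt (D / N) * (1 + Metric.diam C) ^ d := by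
  have hgf : IsFiniteMeasure (tilt h (gaussianMeasure d K)) := by
    apply tilt_fin
    have := (gauss_laplace hK (fun i => (h i : ℂ))).1.norm
    refine this.congr (ae_of_all _ fun y => ?_)
    simp only [Complex.norm_exp]
    congr 1
    rw [Complex.re_sum]
    refine Finset.sum_congr rfl fun i _ => ?_
    simp
  obtain ⟨c0, ε0, Cφ, c2, hc0, hε0, hCφ, hc2, hF⟩ := fourier_close hd hK
    (B * ∑ i, ∑ j, |K i j|) ((2 * A * Real.exp 1) ^ 3) (8 * A * Real.exp 1)
    (mul_nonneg hB.le (Finset.sum_nonneg fun _ _ => Finset.sum_nonneg fun _ _ => abs_nonneg _))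
    (by positivity) (by positivity) h
  obtain ⟨κ, c, hκ, hc, hkb⟩ := kernel_bound (d := d) (c0 / (4 * Real.pi)) (by positivity)
  obtain ⟨Q, hQ, hshell⟩ := gauss_shell (K := K) hd h
  obtain ⟨R, hR, hRκ⟩ := exists_tail κ (1 / (4 * 3 ^ d)) (by positivity)
  set Φ : EuclideanSpace ℝ (Fin d) → ℝ := fun η => Cφ * Real.exp (-c2 * ‖η‖ ^ 2) with hΦ
  have hΦ0 : ∀ x, 0 ≤ Φ x := fun x => by positivity
  have hΦi : Integrable Φ := by
    have h1 := GaussianFourier.integrable_cexp_neg_mul_sq_norm_add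
      (V := EuclideanSpace ℝ (Fin d)) (b := (c2 : ℂ)) (by simpa using hc2) 0 0
    have h2 := (h1.norm).const_mul Cφ
    refine h2.congr (ae_of_all _ fun y => ?_)
    simp only [hΦ, Complex.norm_exp]
    congr 2
    simp [← Complex.ofReal_pow]
  have hΦc : Continuous Φ := by fun_prop
  set M := c * ∫ η, Φ η with hM
  have hM0 : 0 ≤ M := mul_nonneg hc (integral_nonneg hΦ0)
  set vb := volume.real (Metric.ball (0 : EuclideanSpace ℝ (Fin d)) 1) with hvb
  have hvb0 : 0 ≤ vb := measureReal_nonneg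
  refine ⟨2 * (2 * Q * R + 2 * 3 ^ d * vb * M), min ε0 (1 / R), by positivity, by positivity, hgf, ?_⟩
  intro Ω _ ℙ hP S N D H hε
  have hN := H.hN
  have hD := H.hD
  have hεp : 0 < Real.sqrt (D / N) := Real.sqrt_pos.2 (by positivity)
  set ε := Real.sqrt (D / N) with hεd
  have hε1 : ε ≤ ε0 := hε.trans (min_le_left _ _)
  have hRε : R * ε ≤ 1 := by
    have := hε.trans (min_le_right _ _)
    rw [le_div_iff₀ hR] at this
    linarith
  have hYm : Measurable (fun ω => (Real.sqrt (N * D))⁻¹ • S ω) := by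
    have := H.meas
    fun_prop
  have hmf : IsFiniteMeasure (tilt h (lawY ℙ S N D)) := by
    apply tilt_fin
    have hcont : Continuous (fun y : EuclideanSpace ℝ (Fin d) => Real.exp (∑ i, h i * y i)) := by
      fun_prop
    rw [integrable_map_measure hcont.aestronglyMeasurable hYm.aemeasurable]
    have h0 := (hF ε hεp hε1 0 (by simp; positivity)).1
    have h1 := exp_norm_int hA H (fun i => (h i : ℂ)) (by simpa using h0)
    refine h1.mono' (hcont.measurable.comp hYm).aestronglyMeasurable (ae_of_all _ fun ω => ?_)
    simp only [Function.comp]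
    rw [Real.norm_of_nonneg (Real.exp_nonneg _)]
    apply Real.exp_le_exp.2
    rw [← sum_linf]
    have : (((∑ i, h i * ((Real.sqrt (N * D))⁻¹ • S ω) i : ℝ)) : ℂ) =
      ∑ i, (h i : ℂ) * ((((Real.sqrt (N * D))⁻¹ • S ω) i : ℝ) : ℂ) := by push_cast; rfl
    rw [← this, Complex.norm_real]
    exact le_abs_self _
  refine ⟨hmf, ?_⟩
  intro C hC hCm hCb
  refine smoothing _ _ κ Q M R ε hQ hM0 hR hεp hRε hshell hRκ ?_ C hC hCm hCb
  refine hkb Φ hΦ0 hΦi hΦc ε hεp _ _ hmf hgf ?_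
  intro η hη
  rw [mul_div_cancel₀ _ (by positivity : (4 * Real.pi) ≠ 0)] at hη
  obtain ⟨hz, hcl⟩ := hF ε hεp hε1 η hη
  rw [tilt_cf, tilt_cf, (gauss_laplace hK _).2]
  rw [integral_map hYm.aemeasurable (by
    apply Continuous.aestronglyMeasurable; fun_prop)]
  obtain ⟨r, hr, he⟩ := laplace_main hA H (fun i => (h i : ℂ) + Complex.I * (η i : ℂ)) hz
  simp only [sum_linf S _ (fun i => (h i : ℂ) + Complex.I * (η i : ℂ))]
  rw [he]
  exact hcl r hr

end perh

section assembly
variable {d : ℕ} {K : Matrix (Fin d) (Fin d) ℝ}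

/-- linear functional of the tilt -/
def ell (h : Fin d → ℝ) (y : EuclideanSpace ℝ (Fin d)) : ℝ := ∑ i, h i * y i

lemma ell_cont (h : Fin d → ℝ) : Continuous (ell h) := by unfold ell; fun_prop

lemma layer (h : Fin d → ℝ) (μ : Measure (EuclideanSpace ℝ (Fin d))) [IsFiniteMeasure μ]
    (E : Set (EuclideanSpace ℝ (Fin d))) (hE : MeasurableSet E) (hE0 : ∀ y ∈ E, 0 ≤ ell h y) :
    ∫⁻ t in Set.Ioi (0 : ℝ), ENNReal.ofReal (Real.exp (-t)) * tilt h μ (E ∩ {y | ell h y < t}) =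
      μ E := by
  have hlm : Measurable (ell h) := (ell_cont h).measurable
  set G : Set (ℝ × EuclideanSpace ℝ (Fin d)) := {p | p.2 ∈ E ∧ ell h p.2 < p.1} with hG
  have hGm : MeasurableSet G :=
    (measurable_snd hE).inter (measurableSet_lt (hlm.comp measurable_snd) measurable_fst)
  set f : ℝ → EuclideanSpace ℝ (Fin d) → ℝ≥0∞ := fun t y =>
    G.indicator (fun p => ENNReal.ofReal (Real.exp (-p.1)) * ENNReal.ofReal (Real.exp (ell h p.2)))
      (t, y) with hf
  have hfm : Measurable (Function.uncurry f) := by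
    have : Measurable (G.indicator (fun p : ℝ × EuclideanSpace ℝ (Fin d) =>
      ENNReal.ofReal (Real.exp (-p.1)) * ENNReal.ofReal (Real.exp (ell h p.2)))) := by
      apply Measurable.indicator _ hGm
      have h2 : Measurable (fun p : ℝ × EuclideanSpace ℝ (Fin d) => ell h p.2) :=
        hlm.comp measurable_snd
      fun_prop
    exact this
  have h1 : ∀ t : ℝ, ENNReal.ofReal (Real.exp (-t)) * tilt h μ (E ∩ {y | ell h y < t}) =
      ∫⁻ y, f t y ∂μ := by
    intro t
    have hm : MeasurableSet (E ∩ {y | ell h y < t}) :=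
      hE.inter (measurableSet_lt hlm measurable_const)
    unfold tilt
    rw [withDensity_apply _ hm, ← lintegral_const_mul _ (by
      have := hlm
      unfold ell at this
      fun_prop), ← lintegral_indicator hm]
    rfl
  simp_rw [h1]
  rw [lintegral_lintegral_swap hfm.aemeasurable]
  have h2 : ∀ y, ∫⁻ t in Set.Ioi (0 : ℝ), f t y = E.indicator 1 y := by
    intro y
    by_cases hy : y ∈ E
    · have hl := hE0 y hy
      have e : ∀ t, f t y = (Set.Ioi (ell h y)).indicator
          (fun t => ENNReal.ofReal (Real.exp (-t)) * ENNReal.ofReal (Real.exp (ell h y))) t := by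
        intro t
        simp only [hf, Set.indicator, hG]
        by_cases ht : ell h y < t
        · rw [if_pos ⟨hy, ht⟩, if_pos (Set.mem_Ioi.2 ht)]
        · rw [if_neg (fun q => ht q.2), if_neg (fun q => ht (Set.mem_Ioi.1 q))]
      simp_rw [e]
      rw [lintegral_indicator measurableSet_Ioi, Measure.restrict_restrict measurableSet_Ioi,
        Set.Ioi_inter_Ioi, sup_eq_left.2 hl, lintegral_mul_const _ (by fun_prop),
        ← ofReal_integral_eq_lintegral_ofReal (integrableOn_exp_neg_Ioi _)
          (ae_of_all _ fun _ => Real.exp_nonneg _), integral_exp_neg_Ioi,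
        ← ENNReal.ofReal_mul (Real.exp_nonneg _), ← Real.exp_add]
      simp [hy]
    · have e : ∀ t, f t y = 0 := by
        intro t
        simp only [hf, Set.indicator, hG]
        rw [if_neg (fun q => hy q.1)]
      simp [e, hy]
  simp_rw [h2]
  rw [lintegral_indicator_one hE]

lemma layer_real (h : Fin d → ℝ) (μ : Measure (EuclideanSpace ℝ (Fin d))) [IsFiniteMeasure μ]
    [IsFiniteMeasure (tilt h μ)]
    (E : Set (EuclideanSpace ℝ (Fin d))) (hE : MeasurableSet E) (hE0 : ∀ y ∈ E, 0 ≤ ell h y) :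
    IntegrableOn (fun t => Real.exp (-t) * (tilt h μ).real (E ∩ {y | ell h y < t})) (Set.Ioi 0) ∧
    ∫ t in Set.Ioi (0 : ℝ), Real.exp (-t) * (tilt h μ).real (E ∩ {y | ell h y < t}) =
      μ.real E := by
  have hl := layer h μ E hE hE0
  have hmono : Monotone (fun t : ℝ => tilt h μ (E ∩ {y | ell h y < t})) := by
    intro s t hst
    apply measure_mono
    rintro y ⟨hy, hy2⟩
    exact ⟨hy, lt_of_lt_of_le hy2 hst⟩
  have hm : Measurable (fun t : ℝ => ENNReal.ofReal (Real.exp (-t)) *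
      tilt h μ (E ∩ {y | ell h y < t})) := by
    have := hmono.measurable
    fun_prop
  have e : (fun t => Real.exp (-t) * (tilt h μ).real (E ∩ {y | ell h y < t})) =
      fun t => (ENNReal.ofReal (Real.exp (-t)) * tilt h μ (E ∩ {y | ell h y < t})).toReal := by
    ext t
    rw [ENNReal.toReal_mul, ENNReal.toReal_ofReal (Real.exp_nonneg _)]
    rfl
  rw [e]
  constructor
  · exact integrable_toReal_of_lintegral_ne_top hm.aemeasurable (by
      rw [hl]; exact measure_ne_top _ _)
  · rw [integral_toReal hm.aemeasurable, hl]
    · rfl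
    · exact ae_of_all _ fun t => ENNReal.mul_lt_top ENNReal.ofReal_lt_top (measure_lt_top _ _)

lemma poly_exp (d : ℕ) (t : ℝ) (ht : 0 ≤ t) :
    (1 + 2 * t) ^ d ≤ d.factorial * 4 ^ d * Real.exp (1 / 4) * Real.exp (t / 2) := by
  have h := Real.pow_div_factorial_le_exp ((1 + 2 * t) / 4) (by positivity) d
  rw [div_le_iff₀ (by positivity), div_pow, div_le_iff₀ (by positivity)] at h
  refine h.trans (le_of_eq ?_)
  rw [show (1 + 2 * t) / 4 = 1 / 4 + t / 2 by ring, Real.exp_add]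
  ring

/-- orthant bound -/
lemma orthant_bound (h : Fin d → ℝ) (μ γ : Measure (EuclideanSpace ℝ (Fin d)))
    [IsFiniteMeasure μ] [IsFiniteMeasure γ]
    [IsFiniteMeasure (tilt h μ)] [IsFiniteMeasure (tilt h γ)] (c : ℝ) (hc : 0 ≤ c)
    (hb : ∀ C : Set (EuclideanSpace ℝ (Fin d)), Convex ℝ C → MeasurableSet C →
      Bornology.IsBounded C →
      |(tilt h μ).real C - (tilt h γ).real C| ≤ c * (1 + Metric.diam C) ^ d)
    (E : Set (EuclideanSpace ℝ (Fin d))) (hE : MeasurableSet E) (hEc : Convex ℝ E)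
    (hE0 : ∀ y ∈ E, ‖y‖ ≤ ell h y) :
    |μ.real E - γ.real E| ≤ c * (2 * (d.factorial * 4 ^ d * Real.exp (1 / 4))) := by
  have hE0' : ∀ y ∈ E, 0 ≤ ell h y := fun y hy => (norm_nonneg _).trans (hE0 y hy)
  obtain ⟨i1, e1⟩ := layer_real h μ E hE hE0'
  obtain ⟨i2, e2⟩ := layer_real h γ E hE hE0'
  rw [← e1, ← e2, ← integral_sub i1 i2]
  set L : ℝ := d.factorial * 4 ^ d * Real.exp (1 / 4) with hL
  have hint := (integrableOn_exp_mul_Ioi (a := -(1 / 2 : ℝ)) (by norm_num) 0).const_mul (c * L)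
  have hval := integral_exp_mul_Ioi (a := -(1 / 2 : ℝ)) (by norm_num) 0
  have := norm_integral_le_of_norm_le (μ := volume.restrict (Set.Ioi (0 : ℝ))) hint
    (f := fun t => Real.exp (-t) * (tilt h μ).real (E ∩ {y | ell h y < t}) -
      Real.exp (-t) * (tilt h γ).real (E ∩ {y | ell h y < t})) ?_
  · rw [integral_const_mul, hval] at this
    refine this.trans (le_of_eq ?_)
    simp
    ring
  · refine (ae_restrict_iff' measurableSet_Ioi).2 (ae_of_all _ fun t ht => ?_)
    have ht0 : (0 : ℝ) < t := ht
    have hsub : E ∩ {y | ell h y < t} ⊆ Metric.closedBall 0 t := by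
      rintro y ⟨hy, hy2⟩
      rw [mem_closedBall_zero_iff]
      exact (hE0 y hy).trans (le_of_lt hy2)
    have hlin : IsLinearMap ℝ (ell h) := by
      constructor
      · intro x y
        simp [ell, mul_add, Finset.sum_add_distrib]
      · intro a x
        simp only [ell, smul_eq_mul, PiLp.smul_apply]
        rw [Finset.mul_sum]
        exact Finset.sum_congr rfl fun i _ => by ring
    have hcv : Convex ℝ (E ∩ {y | ell h y < t}) := hEc.inter (convex_halfSpace_lt hlin t)
    have hmm : MeasurableSet (E ∩ {y | ell h y < t}) :=
      hE.inter (measurableSet_lt (ell_cont h).measurable measurable_const)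
    have h1 := hb _ hcv hmm (Metric.isBounded_closedBall.subset hsub)
    have hdiam : Metric.diam (E ∩ {y | ell h y < t}) ≤ 2 * t :=
      (Metric.diam_mono hsub Metric.isBounded_closedBall).trans (Metric.diam_closedBall ht0.le)
    rw [← mul_sub, Real.norm_eq_abs, abs_mul, abs_of_nonneg (Real.exp_nonneg _)]
    have hd0 : 0 ≤ Metric.diam (E ∩ {y | ell h y < t}) := Metric.diam_nonneg
    calc _ ≤ Real.exp (-t) * (c * (1 + Metric.diam (E ∩ {y | ell h y < t})) ^ d) := by gcongr
      _ ≤ Real.exp (-t) * (c * (1 + 2 * t) ^ d) := by gcongr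
      _ ≤ Real.exp (-t) * (c * (L * Real.exp (t / 2))) := by
        gcongr
        exact poly_exp d t ht0.le
      _ = c * L * (Real.exp (-t) * Real.exp (t / 2)) := by ring
      _ = _ := by
        rw [← Real.exp_add]
        congr 2
        ring

/-- sign vector -/
def sgv (σ : Fin d → Bool) (i : Fin d) : ℝ := if σ i then 1 else -1

/-- orthant -/
def orth (σ : Fin d → Bool) : Set (EuclideanSpace ℝ (Fin d)) :=
  ⋂ i, if σ i then {y | 0 ≤ y i} else {y | y i < 0}

lemma orth_meas (σ : Fin d → Bool) : MeasurableSet (orth σ) := by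
  refine MeasurableSet.iInter fun i => ?_
  have : Measurable (fun y : EuclideanSpace ℝ (Fin d) => y i) := by fun_prop
  split_ifs
  · exact measurableSet_le measurable_const this
  · exact measurableSet_lt this measurable_const

lemma orth_convex (σ : Fin d → Bool) : Convex ℝ (orth σ) := by
  refine convex_iInter fun i => ?_
  have : IsLinearMap ℝ (fun y : EuclideanSpace ℝ (Fin d) => y i) := ⟨by simp, by simp⟩
  split_ifs
  · exact convex_halfSpace_ge this 0
  · exact convex_halfSpace_lt this 0

lemma mem_orth (σ : Fin d → Bool) (y : EuclideanSpace ℝ (Fin d)) :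
    y ∈ orth σ ↔ σ = fun i => decide (0 ≤ y i) := by
  unfold orth
  rw [Set.mem_iInter, funext_iff]
  refine forall_congr' fun i => ?_
  cases hσ : σ i
  · simp
  · simp

lemma orth_norm (σ : Fin d → Bool) (y : EuclideanSpace ℝ (Fin d)) (hy : y ∈ orth σ) :
    ‖y‖ ≤ ell (sgv σ) y := by
  have h : ell (sgv σ) y = ∑ i, ‖y i‖ := by
    refine Finset.sum_congr rfl fun i _ => ?_
    rw [mem_orth] at hy
    have hi := congrFun hy i
    unfold sgv
    rw [Real.norm_eq_abs]
    by_cases h0 : 0 ≤ y i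
    · simp [hi, h0, abs_of_nonneg h0]
    · simp [hi, h0, abs_of_neg (not_le.1 h0)]
  rw [h, EuclideanSpace.norm_eq, Real.sqrt_le_left (Finset.sum_nonneg fun _ _ => norm_nonneg _)]
  exact Finset.sum_sq_le_sq_sum_of_nonneg fun _ _ => norm_nonneg _

lemma orth_decomp (μ : Measure (EuclideanSpace ℝ (Fin d))) [IsFiniteMeasure μ]
    (C : Set (EuclideanSpace ℝ (Fin d))) (hC : MeasurableSet C) :
    μ.real C = ∑ σ : Fin d → Bool, μ.real (C ∩ orth σ) := by
  rw [← measureReal_biUnion_finset]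
  · congr 1
    ext y
    simp only [Finset.mem_univ, Set.iUnion_true, Set.mem_iUnion, Set.mem_inter_iff, mem_orth]
    simp
  · intro σ _ τ _ hne
    refine Set.disjoint_left.2 fun y h1 h2 => hne ?_
    rw [(mem_orth _ _).1 h1.2, (mem_orth _ _).1 h2.2]
  · exact fun σ _ => hC.inter (orth_meas σ)

lemma final_bound (hd : 0 < d) (hK : K.PosDef) {A B : ℝ} (hA : 0 < A) (hB : 0 < B) :
    ∃ C0 ε0 : ℝ, 0 < ε0 ∧
    ∀ (Ω : Type) (_ : MeasurableSpace Ω) (ℙ : Measure Ω) (_ : IsProbabilityMeasure ℙ)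
      (S : Ω → EuclideanSpace ℝ (Fin d)) (N D : ℝ), MCHyp K A B ℙ S N D →
      Real.sqrt (D / N) ≤ ε0 →
      convexDist (lawY ℙ S N D) (gaussianMeasure d K) ≤ C0 * Real.sqrt (D / N) := by
  choose Ch εh hCh hεh hgf hmain using fun σ : Fin d → Bool => per_h hd hK hA hB (sgv σ)
  have hgp := gauss_prob hK
  set L : ℝ := 2 * (d.factorial * 4 ^ d * Real.exp (1 / 4)) with hL
  refine ⟨∑ σ, Ch σ * L, Finset.univ.inf' Finset.univ_nonempty εh, ?_, ?_⟩
  · rw [Finset.lt_inf'_iff]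
    exact fun σ _ => hεh σ
  · intro Ω _ ℙ hP S N D H hε
    have hYm : Measurable (fun ω => (Real.sqrt (N * D))⁻¹ • S ω) := by
      have := H.meas
      fun_prop
    have hYp : IsProbabilityMeasure (lawY ℙ S N D) :=
      Measure.isProbabilityMeasure_map hYm.aemeasurable
    unfold convexDist
    have : Nonempty {C : Set (EuclideanSpace ℝ (Fin d)) // Convex ℝ C ∧ MeasurableSet C} :=
      ⟨⟨∅, convex_empty, MeasurableSet.empty⟩⟩
    refine ciSup_le fun C => ?_
    obtain ⟨C, hC, hCm⟩ := C
    change |(lawY ℙ S N D).real C - (gaussianMeasure d K).real C| ≤ _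
    rw [orth_decomp _ C hCm, orth_decomp (gaussianMeasure d K) C hCm, ← Finset.sum_sub_distrib,
      Finset.sum_mul]
    refine (Finset.abs_sum_le_sum_abs _ _).trans (Finset.sum_le_sum fun σ _ => ?_)
    obtain ⟨hmf, hb⟩ := hmain σ Ω _ ℙ hP S N D H
      (hε.trans (Finset.inf'_le _ (Finset.mem_univ σ)))
    have := hgf σ
    have hc := hCh σ
    have := orthant_bound (sgv σ) (lawY ℙ S N D) (gaussianMeasure d K)
      (Ch σ * Real.sqrt (D / N)) (by positivity) hb (C ∩ orth σ) (hCm.inter (orth_meas σ))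
      (hC.inter (orth_convex σ)) (fun y hy => orth_norm σ y hy.2)
    refine this.trans (le_of_eq ?_)
    rw [← hL]
    ring

end assembly

/-- Method of cumulants with hypotheses (MC1), (MC2') and (MC3): there is a
constant `C = C(d,K,A,B)`, depending only on `d`, `K`, `A`, `B`, such that for every sequence
of centered random vectors satisfying the hypotheses and all `n` large enough,
`d_convex(Y_n, N(0,K)) ≤ C √(D_n/N_n)` where `Y_n = S_n/√(N_n D_n)`. -/
theorem method_of_cumulants_speed_of_convergence
    (d : ℕ) (hd : 0 < d) (K : Matrix (Fin d) (Fin d) ℝ) (hK : K.PosDef)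
    (A B : ℝ) (hA : 0 < A) (hB : 0 < B) :
    ∃ C : ℝ, ∀ (Ω : Type) (_ : MeasurableSpace Ω) (ℙ : Measure Ω),
      IsProbabilityMeasure ℙ →
      ∀ (S : ℕ → Ω → EuclideanSpace ℝ (Fin d)) (N D : ℕ → ℝ),
      (∀ n, Measurable (S n)) →
      (∀ n, 0 < N n) → (∀ n, 0 < D n) →
      Tendsto (fun n => D n / N n) atTop (𝓝 0) →
      (∀ n (r : ℕ) (i : Fin r → Fin d), Integrable (fun ω => ∏ k, S n ω (i k)) ℙ) →
      -- (MC1) the random vectors are centered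
      (∀ n i, ∫ ω, S n ω i ∂ℙ = 0) →
      -- (MC2') κ(Sⁿ⁽ⁱ⁾, Sⁿ⁽ʲ⁾) = N_n D_n K_ij (1 + O(√(D_n/N_n))) with constant B
      (∀ i j : Fin d, ∃ δ : ℕ → ℝ, (∀ n, |δ n| ≤ B * Real.sqrt (D n / N n)) ∧
        ∀ n, jointCumulant ℙ ![fun ω => S n ω i, fun ω => S n ω j] =
          N n * D n * K i j * (1 + δ n)) →
      -- (MC3)
      (∀ n (r : ℕ), 3 ≤ r → ∀ i : Fin r → Fin d,
        |jointCumulant ℙ (fun k ω => S n ω (i k))| ≤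
          N n * (2 * D n) ^ (r - 1) * A ^ r * (r : ℝ) ^ (r - 2)) →
      ∀ᶠ n in atTop,
        convexDist (Measure.map (fun ω => (Real.sqrt (N n * D n))⁻¹ • S n ω) ℙ)
            (gaussianMeasure d K) ≤
          C * Real.sqrt (D n / N n) := by
  obtain ⟨C0, ε0, hε0, hmain⟩ := final_bound hd hK hA hB
  refine ⟨C0, ?_⟩
  intro Ω _ ℙ hP S N D hm hN hD ht hint hmean hcov hmc3
  have hs : Tendsto (fun n => Real.sqrt (D n / N n)) atTop (𝓝 0) := by
    have := ht.sqrt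
    rwa [Real.sqrt_zero] at this
  filter_upwards [hs.eventually (gt_mem_nhds hε0)] with n hn
  refine hmain Ω _ ℙ hP (S n) (N n) (D n)
    ⟨hm n, hN n, hD n, hint n, hmean n, fun i j => ?_, hmc3 n⟩ hn.le
  obtain ⟨δ, h1, h2⟩ := hcov i j
  exact ⟨δ n, h1 n, h2 n⟩

end
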